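/- Every minimally vertically 4-connected matroid with at least six elements that contains a triangle has a 4-element cocircuit, or a 5-element cocircuit that contains a triangle. -/

import Mathlib

open Set Matroid

universe u

variable {α : Type u}

/-- The rank of a set `X` in a matroid `M`: the supremum of the cardinalities of the
independent subsets of `X`. -/
noncomputable def mrk (M : Matroid α) (X : Set α) : ℕ∞ :=
  ⨆ I ∈ {I : Set α | M.Indep I ∧ I ⊆ X}, I.encard

/-- The rank `r(M)` of a matroid `M`. -/
noncomputable def mrank (M : Matroid α) : ℕ∞ := mrk M M.E

/-- The connectivity function `λ_M(X) = r(X) + r(E(M) - X) - r(M)`. -/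
noncomputable def lam (M : Matroid α) (X : Set α) : ℕ∞ :=
  mrk M X + mrk M (M.E \ X) - mrank M

/-- The deletion `M \ D` of a set of elements `D` from `M`. -/
def mdel (M : Matroid α) (D : Set α) : Matroid α := M ↾ (M.E \ D)

/-- A circuit of a matroid: a minimal dependent set. -/
def MCircuit (M : Matroid α) (C : Set α) : Prop := M.Dep C ∧ ∀ D, D ⊂ C → M.Indep D

/-- A cocircuit of a matroid: a circuit of the dual matroid. -/
def MCocircuit (M : Matroid α) (C : Set α) : Prop := MCircuit M✶ C

/-- A triangle: a 3-element circuit. -/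
def IsTriangle (M : Matroid α) (T : Set α) : Prop := MCircuit M T ∧ T.encard = 3

/-- `(X, Y)` is a vertical `j`-separation of `M`: a partition of `E(M)` with
`λ_M(X) < j` and `min {r(X), r(Y)} ≥ j`. -/
def IsVSep (M : Matroid α) (j : ℕ) (X Y : Set α) : Prop :=
  X ∪ Y = M.E ∧ Disjoint X Y ∧ lam M X < (j : ℕ∞) ∧
    (j : ℕ∞) ≤ mrk M X ∧ (j : ℕ∞) ≤ mrk M Y

/-- An exact vertical `j`-separation: one with `λ_M(X) = j - 1`. -/
def IsExactVSep (M : Matroid α) (j : ℕ) (X Y : Set α) : Prop :=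
  IsVSep M j X Y ∧ lam M X = (j : ℕ∞) - 1

/-- `M` is vertically `k`-connected: it has no vertical `j`-separation for a
positive integer `j < k`. -/
def VertConn (M : Matroid α) (k : ℕ) : Prop :=
  ∀ j X Y, 0 < j → j < k → ¬ IsVSep M j X Y

/-- `(X, Y)` is a (Tutte) `j`-separation of `M`. -/
def IsSep (M : Matroid α) (j : ℕ) (X Y : Set α) : Prop :=
  X ∪ Y = M.E ∧ Disjoint X Y ∧ lam M X < (j : ℕ∞) ∧
    (j : ℕ∞) ≤ X.encard ∧ (j : ℕ∞) ≤ Y.encard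

/-- `M` is (Tutte) `k`-connected. -/
def TConn (M : Matroid α) (k : ℕ) : Prop :=
  ∀ j X Y, 0 < j → j < k → ¬ IsSep M j X Y

/-- `M` is minimally vertically 4-connected. -/
def MinVertConn4 (M : Matroid α) : Prop :=
  VertConn M 4 ∧ ∀ e ∈ M.E, ¬ VertConn (mdel M {e}) 4

/-- `M` is a simple matroid: every subset of the ground set with at most two
elements is independent (no loops and no parallel pairs). -/
def MSimple (M : Matroid α) : Prop := ∀ S ⊆ M.E, S.encard ≤ 2 → M.Indep S

/-- `M` has a restriction isomorphic to `U_{2,4}`: a 4-element subset of the ground set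
of rank 2, all of whose subsets with at most 2 elements are independent. -/
def HasU24Restriction (M : Matroid α) : Prop :=
  ∃ X ⊆ M.E, X.encard = 4 ∧ mrk M X = 2 ∧ ∀ S ⊆ X, S.encard ≤ 2 → M.Indep S

/-- The restriction `M|X` is isomorphic to `U_{2,4}`. -/
def RestrIsoU24 (M : Matroid α) (X : Set α) : Prop :=
  X ⊆ M.E ∧ X.encard = 4 ∧ mrk M X = 2 ∧ ∀ S ⊆ X, S.encard ≤ 2 → M.Indep S

/-- The restriction `M|C` is isomorphic to `U_{2,k} ⊕ U_{2,2}`: `C` is the disjoint union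
of a `k`-element rank-2 set `L` containing no loops or parallel pairs (a copy of `U_{2,k}`)
and a 2-element independent set `P` (a copy of `U_{2,2}`), with `r(C) = r(L) + r(P) = 4`,
so that the restriction is the direct sum of the two pieces. -/
def RestrIsoLinePlusPair (M : Matroid α) (C : Set α) (k : ℕ) : Prop :=
  ∃ L P, C = L ∪ P ∧ Disjoint L P ∧ L.encard = (k : ℕ∞) ∧ P.encard = 2 ∧
    M.Indep P ∧ mrk M L = 2 ∧ (∀ S ⊆ L, S.encard ≤ 2 → M.Indep S) ∧ mrk M C = 4

/-- The restriction `M|X` is isomorphic to the 2-sum `U_{2,4} ⊕₂ U_{2,4}`: `X` is the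
disjoint union of two 3-element circuits `T₁` and `T₂`, and the circuits of `M` contained
in `X` (i.e. the circuits of `M|X`) are exactly `T₁`, `T₂`, and the unions `P₁ ∪ P₂` of
2-element subsets `P₁ ⊆ T₁` and `P₂ ⊆ T₂`. -/
def RestrIsoTwoSumU24U24 (M : Matroid α) (X : Set α) : Prop :=
  X ⊆ M.E ∧ ∃ T₁ T₂ : Set α, Disjoint T₁ T₂ ∧ X = T₁ ∪ T₂ ∧
    T₁.encard = 3 ∧ T₂.encard = 3 ∧
    ∀ C ⊆ X, (MCircuit M C ↔ (C = T₁ ∨ C = T₂ ∨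
      ∃ P₁ P₂, P₁ ⊆ T₁ ∧ P₂ ⊆ T₂ ∧ P₁.encard = 2 ∧ P₂.encard = 2 ∧ C = P₁ ∪ P₂))

/-- The columns of the `GF(3)`-matrix representing `N₉`. -/
def N9Cols : Fin 9 → Fin 4 → ZMod 3 :=
  ![![1, 0, 0, 0], ![0, 1, 0, 0], ![0, 0, 1, 0], ![0, 0, 0, 1], ![0, 1, 1, -1],
    ![1, 0, 1, 1], ![1, 1, 0, 1], ![-1, 1, 1, 0], ![1, -1, 1, -1]]

/-- `M` is isomorphic to `N₉`, the 9-element rank-4 matroid represented over `GF(3)`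
by the matrix with columns `N9Cols`. -/
def IsoN9 (M : Matroid α) : Prop :=
  ∃ φ : α → Fin 9, Set.BijOn φ M.E Set.univ ∧
    ∀ I ⊆ M.E, (M.Indep I ↔ LinearIndependent (ZMod 3) fun x : I => N9Cols (φ x.1))

/-- `M` is binary: representable over the two-element field `GF(2)`, i.e. there is a
map from the ground set to a `GF(2)`-vector space under which independence in `M`
coincides with linear independence. -/
def IsBinary (M : Matroid α) : Prop :=
  ∃ (ι : Type u) (φ : α → ι → ZMod 2),
    ∀ I ⊆ M.E, (M.Indep I ↔ LinearIndependent (ZMod 2) fun x : I => φ x.1)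

/-- `M` is a uniform matroid, i.e. isomorphic to `U_{m,n}` for some `m` and `n`:
the ground set has `n` elements and a subset of the ground set is independent
exactly when it has at most `m` elements. -/
def IsUniform (M : Matroid α) : Prop :=
  ∃ m n : ℕ, M.E.encard = (n : ℕ∞) ∧ ∀ I ⊆ M.E, (M.Indep I ↔ I.encard ≤ (m : ℕ∞))



def SL (z l : ℕ) : Prop :=
  (z = 0 ∧ l = 0) ∨ (z = 1 ∧ l = 1) ∨ (z = 2 ∧ l = 2) ∨ (z = 3 ∧ l = 2) ∨ (3 ≤ z ∧ 3 ≤ l)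

/-- numeric facts about a pair -/
structure PairFacts (k P Q R S s1 s2 p q r s x y : ℕ) : Prop where
  hP : SL P p
  hQ : SL Q q
  hR : SL R r
  hS : SL S s
  qr : q + r ≤ 4
  ps : p + s ≤ 5
  ps' : p ≤ 2 → p + s ≤ 4
  spl : s ≤ 2 → s1 ≤ 1 ∧ s2 ≤ 1
  eq : q = 2 → r = 2 → x = y
  u : p ≤ 2 → s ≤ 2 → k + p ≤ x + y

/-- numeric facts about a side: size `n`, rank `x`, decompositions `1 + P + Q`, `S + Q'` -/
structure SideFacts (n x P Q S Q' p q s q' : ℕ) : Prop where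
  three : 3 ≤ x
  d1 : p ≤ 2 → q ≤ 2 → x ≤ 1 + p + q
  d2 : s ≤ 2 → q' ≤ 2 → x ≤ s + q'
  n4 : x = 3 → 4 ≤ n
  t : x = 3 → n = 4 → (P = 3 → 3 ≤ p) ∧ (Q = 3 → 3 ≤ q) ∧ (S = 3 → 3 ≤ s) ∧ (Q' = 3 → 3 ≤ q')

theorem numeric (m1 m2 m3 m4 m5 m6 z1 z2 pab qab rab sab pbc qbc rbc sbc pca qca rca sca
    r xab xac xbc xba xca xcb : ℕ) (hr : 5 ≤ r)
    (ea : xab + xac = r + 2) (eb : xbc + xba = r + 2) (ec : xca + xcb = r + 2)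
    (Fab : PairFacts r (m1 + m2) (z1 + m3) (z2 + m5) (1 + m6 + m4) m6 m4 pab qab rab sab xab xba)
    (Fbc : PairFacts r (m3 + m4) (z1 + m6) (z2 + m2) (1 + m1 + m5) m1 m5 pbc qbc rbc sbc xbc xcb)
    (Fca : PairFacts r (m5 + m6) (z1 + m1) (z2 + m4) (1 + m2 + m3) m2 m3 pca qca rca sca xca xac)
    (Gab : SideFacts (1 + m1 + m2 + z1 + m3) xab (m1 + m2) (z1 + m3) (1 + m2 + m3) (z1 + m1)
      pab qab sca qca)
    (Gac : SideFacts (1 + m5 + m6 + z2 + m4) xac (m5 + m6) (z2 + m4) (1 + m6 + m4) (z2 + m5)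
      pca rca sab rab)
    (Gbc : SideFacts (1 + m3 + m4 + z1 + m6) xbc (m3 + m4) (z1 + m6) (1 + m6 + m4) (z1 + m3)
      pbc qbc sab qab)
    (Gba : SideFacts (1 + m1 + m2 + z2 + m5) xba (m1 + m2) (z2 + m5) (1 + m1 + m5) (z2 + m2)
      pab rab sbc rbc)
    (Gca : SideFacts (1 + m5 + m6 + z1 + m1) xca (m5 + m6) (z1 + m1) (1 + m1 + m5) (z1 + m6)
      pca qca sbc qbc)
    (Gcb : SideFacts (1 + m3 + m4 + z2 + m2) xcb (m3 + m4) (z2 + m2) (1 + m2 + m3) (z2 + m4)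
      pbc rbc sca rca)
    (z1a : 2 ≤ z1 → qab ≤ 2 → qbc ≤ 2 → z1 + m3 + m6 ≤ 3)
    (z1b : 2 ≤ z1 → qab ≤ 2 → qca ≤ 2 → z1 + m3 + m1 ≤ 3)
    (mac : m1 + m2 + z1 + m3 ≤ m5 + m6 + z2 + m4)
    (mbc : m1 + m2 ≤ m4 + m6)
    (mba : z1 + m3 ≤ z2 + m5)
    (mca : m2 + m3 ≤ m5 + m6)
    (mcb : m1 + z1 ≤ m4 + z2)
    (tbc : m1 + m2 = m4 + m6 → xab ≤ xbc)
    (cab : 4 ≤ xab → pab ≤ 2 → qab ≤ 2 → xab ≤ pab + qab)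
    (cbc : 4 ≤ xbc → m1 + m2 = m4 + m6 → xbc = xab → pbc ≤ 2 → qbc ≤ 2 → xbc ≤ pbc + qbc)
    (cbc' : 4 ≤ xbc → m1 + m2 = m4 + m6 → xbc = xab → 1 ≤ z1 + m3 → sab ≤ 2 →
      xbc + 1 ≤ z1 + m3 + sab) : False := by
  obtain ⟨a1, a2, a3, a4, a5, a6, a7, a8, a9, a10⟩ := Fab
  obtain ⟨b1, b2, b3, b4, b5, b6, b7, b8, b9, b10⟩ := Fbc
  obtain ⟨c1, c2, c3, c4, c5, c6, c7, c8, c9, c10⟩ := Fca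
  obtain ⟨ab1, ab2, ab3, ab4, ab5⟩ := Gab
  obtain ⟨ac1, ac2, ac3, ac4, ac5⟩ := Gac
  obtain ⟨bc1, bc2, bc3, bc4, bc5⟩ := Gbc
  obtain ⟨ba1, ba2, ba3, ba4, ba5⟩ := Gba
  obtain ⟨ca1, ca2, ca3, ca4, ca5⟩ := Gca
  obtain ⟨cb1, cb2, cb3, cb4, cb5⟩ := Gcb
  unfold SL at *
  have q2 : qab ≤ 2 := by clear * - a2 a3 a5 mba; omega
  have p2 : pab ≤ 2 := by clear * - a1 a4 a6 mbc; omega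
  have s4 := a7 p2
  have hx : xab = 3 ∨ xab = 4 := by clear * - ab1 cab p2 q2; omega
  rcases hx with hx | hx
  · -- rank three
    have n4 := ab4 hx
    have hP1 : 1 ≤ m1 + m2 := by
      by_contra h
      have := (ab5 hx)
      clear * - h this n4 a2 q2; omega
    have hQ1 : 1 ≤ z1 + m3 := by
      by_contra h
      have := (ab5 hx)
      clear * - h this n4 a1 p2; omega
    by_cases hP2 : 2 ≤ m1 + m2
    · have hp : pab = 2 := by clear * - a1 p2 hP2; omega
      have hs : sab ≤ 2 := by omega
      have h46 := a8 hs
      have hS : m6 = 1 ∧ m4 = 1 ∧ m1 + m2 = 2 := by clear * - mbc h46 hP2; omega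
      by_cases hQ2 : 2 ≤ z1 + m3
      · have hq : qab = 2 := by clear * - a2 q2 hQ2; omega
        have hr2 : rab = 2 := by clear * - a3 a5 hq hQ2 mba; omega
        have e1 := a9 hq hr2
        have e2 := a10 p2 hs
        clear * - e1 e2 hx hp hr; omega
      · have hq : qab = 1 := by clear * - a2 q2 hQ2 hQ1; omega
        have h3 := bc3 hs q2
        have hx3 : xbc = 3 := by clear * - h3 hs hq bc1; omega
        have := (bc5 hx3 (by clear * - hS hQ1 hQ2; omega)).2.2.1
          (by clear * - hS; omega)
        clear * - this hs; omega
    · have hp : pab = 1 := by clear * - a1 p2 hP2 hP1; omega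
      have hQ2 : 2 ≤ z1 + m3 ∧ z1 + m3 ≤ 3 := by clear * - a2 q2 n4 hP2; omega
      have hq : qab = 2 := by clear * - a2 q2 hQ2; omega
      have hr2 : rab = 2 := by clear * - a3 a5 hq hQ2 mba; omega
      have hR3 : z2 + m5 ≤ 3 := by clear * - a3 hr2; omega
      have e1 := a9 hq hr2
      have hm3 : m3 ≤ 1 := by
        by_contra h
        have : ¬ sca ≤ 2 := fun hh => by have := c8 hh; omega
        have : pca ≤ 1 := by clear * - c6 c7 this; omega
        clear * - c1 this mca h; omega
      have K : ¬ (qbc = 2 ∧ rbc = 2 ∧ qca = 2 ∧ rca = 2) := by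
        rintro ⟨h1, h2, h3, h4⟩
        have := b9 h1 h2
        have := c9 h3 h4
        omega
      have hqca : qca ≤ 2 := by clear * - c2 c3 c5 mcb; omega
      have hsca : sca ≤ 2 := by clear * - c1 c4 c6 c7 mca; omega
      have h5 := ab5 hx
      have hP : m1 + m2 = 1 := by clear * - hP1 hP2; omega
      have hz1b : 2 ≤ z1 → z1 + m3 + m1 ≤ 3 := fun h => z1b h q2 hqca
      by_cases hm1 : m1 = 1
      · have hz : z1 = 1 ∧ m3 = 1 := by clear * - h5 hz1b hm1 hP hQ2 hm3 hqca; omega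
        obtain ⟨hz, hm⟩ := hz
        have hm2 : m2 = 0 := by clear * - hP hm1; omega
        subst hz hm hm1 hm2
        have q3 : qca = 2 := by clear * - c2; omega
        have r3 : rca = 2 := by clear * - c3 c5 q3 mcb; omega
        have e3 := c9 q3 r3
        by_cases hz2 : 2 ≤ z2
        · have hrbc : 2 ≤ rbc := by clear * - b3 hz2; omega
          by_cases hm6 : 1 ≤ m6
          · apply K
            clear * - b2 b5 hrbc hm6 q3 r3; omega
          · have h4 : m6 = 0 ∧ z2 = 2 ∧ m4 = 1 ∧ m5 = 1 := by
              clear * - hm6 hz2 mca mbc hR3 c3 r3; omega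
            obtain ⟨h41, h42, h43, h44⟩ := h4
            subst h41 h42 h43 h44
            have hpb : pbc = 2 := by clear * - b1; omega
            have hqb : qbc = 1 := by clear * - b2; omega
            have := b7 (by omega)
            have := bc2 (by omega) (by omega)
            have := ca3 (by omega) (by omega)
            clear * - e1 e3 ea eb ec hx this hr hpb hqb b7 bc2; omega
        · have h4 : 1 ≤ m5 ∧ 1 ≤ m4 := by clear * - hz2 mba mcb; omega
          have hpb : 2 ≤ pbc := by clear * - b1 h4; omega
          have hsb : sbc ≤ 2 := by clear * - hpb b6 b7; omega
          have h8 := b8 hsb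
          have h9 : m5 = 1 ∧ z2 = 1 := by clear * - h8 h4 mba hz2; omega
          have := (ba5 (by omega) (by omega)).2.2.1 (by omega)
          omega
      · have hm1' : m1 = 0 := by clear * - hP hm1; omega
        have hm2 : m2 = 1 := by clear * - hP hm1'; omega
        subst hm1' hm2
        have hz : 2 ≤ z1 := by
          clear * - h5 hQ2 hm3 hsca; omega
        have q3 : qca = 2 := by clear * - c2 hqca hz; omega
        have r3 : rca = 2 := by clear * - c3 c5 q3 mcb hz; omega
        by_cases hz2 : z2 = 0
        · have : 2 ≤ m5 := by clear * - hz2 mba hz; omega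
          have hs : ¬ sbc ≤ 2 := fun h => by have := b8 h; omega
          clear * - hs b1 b6 b7 hz2 hz mcb; omega
        · apply K
          clear * - b2 b3 b5 b8 q3 r3 hz hz2 mca mbc mcb
          have : 2 ≤ rbc := by omega
          have : 2 ≤ qbc := by omega
          omega
  · have := cab (by omega) p2 q2
    have hp : pab = 2 := by clear * - this p2 q2 hx; omega
    have hq : qab = 2 := by clear * - this p2 q2 hx; omega
    have hs : sab ≤ 2 := by clear * - hp s4; omega
    have h8 := a8 hs
    have h46 : m4 = 1 ∧ m6 = 1 ∧ m1 + m2 = 2 := by clear * - h8 mbc hp a1; omega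
    obtain ⟨h4, h6, h12⟩ := h46
    subst h4 h6
    have hr2 : rab = 2 := by clear * - a2 a3 a5 hq mba; omega
    have t := tbc h12
    have h3 := bc3 hs q2
    have hxb : xbc = 4 := by clear * - t h3 hs hq hx; omega
    have c' := cbc' (by omega) h12 (by omega) (by clear * - a2 hq; omega) hs
    have hz : z1 + m3 = 3 := by clear * - c' hxb hs a2 hq; omega
    have hc := cbc (by omega) h12 (by omega)
    have hR : z2 + m5 = 3 := by clear * - a3 hr2 hz mba; omega
    have hm3 : m3 ≤ 1 := by
      by_contra h
      have : ¬ sca ≤ 2 := fun hh => by have := c8 hh; omega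
      clear * - this c6 c7 c1 mca h; omega
    have hz1 := z1a (by omega) q2
    have hqb : 3 ≤ qbc := by
      clear * - hz1 hz hm3 b2
      by_contra h
      have := hz1 (by omega)
      omega
    have hrb : rbc ≤ 1 := by clear * - b5 hqb; omega
    clear * - b3 hrb hz hm3 mcb h12; omega

structure TSep {α : Type u} [DecidableEq α] (E : Finset α) (ρ : Finset α → ℕ) (e : α)
    (X Y : Finset α) : Prop where
  mem : ∀ x, x ∈ E ↔ x ∈ X ∨ x ∈ Y ∨ x = e
  disj : ∀ x, x ∈ X → x ∉ Y
  eX : e ∉ X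
  eY : e ∉ Y
  sum : ρ X + ρ Y ≤ ρ E + 2
  three : 3 ≤ ρ X
  three' : 3 ≤ ρ Y

structure RS {α : Type u} [DecidableEq α] (E : Finset α) (ρ : Finset α → ℕ) : Prop where
  mono : ∀ A B, A ⊆ B → ρ A ≤ ρ B
  submod : ∀ A B, ρ (A ∪ B) + ρ (A ∩ B) ≤ ρ A + ρ B
  empty : ρ ∅ = 0
  ins : ∀ x A, ρ (insert x A) ≤ ρ A + 1
  size : ∀ Z, Z ⊆ E → Z.card < 2 ^ ρ Z
  V : ∀ Z, Z ⊆ E → ρ Z + ρ (E \ Z) ≤ ρ E + 2 → ρ Z = ρ E ∨ ρ (E \ Z) = ρ E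
  N : ∀ H, H ⊆ E → ρ H + 1 = ρ E → 5 ≤ (E \ H).card ∧
    ((E \ H).card = 5 → ∀ Z, Z ⊆ E \ H → Z.card = 3 → 3 ≤ ρ Z)
  sep : ∀ e ∈ E, ∃ X Y, TSep E ρ e X Y

structure Tri {α : Type u} [DecidableEq α] (E : Finset α) (ρ : Finset α → ℕ) (a b c : α) :
    Prop where
  ha : a ∈ E
  hb : b ∈ E
  hc : c ∈ E
  ab : a ≠ b
  ac : a ≠ c
  bc : b ≠ c
  rk : ρ {a, b, c} ≤ 2

section abs
variable {α : Type u} [DecidableEq α] {E : Finset α} {ρ : Finset α → ℕ}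

theorem TSep.symm {e : α} {X Y : Finset α} (s : TSep E ρ e X Y) : TSep E ρ e Y X :=
  ⟨fun x => by rw [s.mem x]; tauto, fun x h h' => s.disj x h' h, s.eY, s.eX,
    by have := s.sum; omega, s.three', s.three⟩

theorem TSep.subX {e : α} {X Y : Finset α} (s : TSep E ρ e X Y) : X ⊆ E :=
  fun x hx => (s.mem x).2 (Or.inl hx)

theorem TSep.subY {e : α} {X Y : Finset α} (s : TSep E ρ e X Y) : Y ⊆ E := s.symm.subX

theorem Tri.rot {a b c : α} (t : Tri E ρ a b c) : Tri E ρ b c a :=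
  ⟨t.hb, t.hc, t.ha, t.bc, t.ab.symm, t.ac.symm, by
    have : ({b, c, a} : Finset α) = {a, b, c} := by ext x; simp; tauto
    rw [this]; exact t.rk⟩

theorem Tri.swap {a b c : α} (t : Tri E ρ a b c) : Tri E ρ a c b :=
  ⟨t.ha, t.hc, t.hb, t.ac, t.ab, t.bc.symm, by
    have : ({a, c, b} : Finset α) = {a, b, c} := by ext x; simp; tauto
    rw [this]; exact t.rk⟩

theorem RS.le_card (h : RS E ρ) (Z : Finset α) : ρ Z ≤ Z.card := by
  induction Z using Finset.induction_on with
  | empty => simp [h.empty]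
  | insert x A hx ih => rw [Finset.card_insert_of_notMem hx]; have := h.ins x A; omega

theorem RS.union_le (h : RS E ρ) (A B : Finset α) : ρ (A ∪ B) ≤ ρ A + ρ B := by
  have := h.submod A B; omega

theorem RS.card2 (h : RS E ρ) {Z : Finset α} (hZ : Z ⊆ E) (h2 : ρ Z ≤ 2) : Z.card ≤ 3 := by
  have := h.size Z hZ
  have h3 : 2 ^ ρ Z ≤ 2 ^ 2 := Nat.pow_le_pow_right (by norm_num) h2
  omega

theorem RS.card1 (h : RS E ρ) {Z : Finset α} (hZ : Z ⊆ E) (h2 : ρ Z ≤ 1) : Z.card ≤ 1 := by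
  have := h.size Z hZ
  have h3 : 2 ^ ρ Z ≤ 2 ^ 1 := Nat.pow_le_pow_right (by norm_num) h2
  omega

theorem RS.card0 (h : RS E ρ) {Z : Finset α} (hZ : Z ⊆ E) (h2 : ρ Z ≤ 0) : Z.card = 0 := by
  have := h.size Z hZ
  have h3 : 2 ^ ρ Z ≤ 2 ^ 0 := Nat.pow_le_pow_right (by norm_num) h2
  omega

/-- two sets sharing at least two elements -/
theorem RS.share (h : RS E ρ) {A B : Finset α} (hA : A ⊆ E) (h2 : 2 ≤ (A ∩ B).card) :
    ρ (A ∪ B) + 2 ≤ ρ A + ρ B := by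
  have := h.submod A B
  have : ¬ ρ (A ∩ B) ≤ 1 := fun h' => by
    have := h.card1 (Finset.inter_subset_left.trans hA) h'
    omega
  omega

theorem RS.tri (h : RS E ρ) {a b c : α} (t : Tri E ρ a b c) {Z : Finset α} (ha : a ∈ Z)
    (hb : b ∈ Z) : ρ (insert c Z) ≤ ρ Z := by
  have hs : ({a, b, c} : Finset α) ⊆ E := by
    intro x hx
    simp only [Finset.mem_insert, Finset.mem_singleton] at hx
    rcases hx with rfl | rfl | rfl
    · exact t.ha
    · exact t.hb
    · exact t.hc
  have h2 : 2 ≤ (({a, b, c} : Finset α) ∩ Z).card := by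
    rw [← Finset.card_pair t.ab]
    apply Finset.card_le_card
    intro x hx
    simp only [Finset.mem_insert, Finset.mem_singleton] at hx
    simp only [Finset.mem_inter, Finset.mem_insert, Finset.mem_singleton]
    rcases hx with rfl | rfl <;> simp [ha, hb]
  have := h.share hs h2
  have h3 := h.mono (insert c Z) ({a, b, c} ∪ Z) (by intro x; simp; tauto)
  have := t.rk
  omega

theorem RS.sepE (_h : RS E ρ) {e : α} {X Y : Finset α} (s : TSep E ρ e X Y) :
    E \ Y = insert e X := by
  ext x
  have h1 := s.mem x
  have h2 := s.disj x
  have h3 := s.eY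
  simp only [Finset.mem_sdiff, Finset.mem_insert]
  constructor
  · tauto
  · rintro (rfl | hx)
    · exact ⟨h1.2 (by tauto), h3⟩
    · tauto

theorem RS.sepX (h : RS E ρ) {e : α} {X Y : Finset α} (s : TSep E ρ e X Y) :
    ρ X + ρ Y = ρ E + 2 ∧ ρ (insert e X) = ρ X + 1 := by
  have hE := h.sepE s
  have h1 := h.ins e X
  have h2 := h.mono X (insert e X) (Finset.subset_insert _ _)
  have hV := h.V Y s.subY
  rw [hE] at hV
  have := s.sum
  have := s.three
  have := s.three'
  have key : ¬ (ρ Y + ρ (insert e X) ≤ ρ E + 2) := fun hh => by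
    rcases hV hh with h' | h' <;> omega
  omega

def lamb (E : Finset α) (ρ : Finset α → ℕ) (Z : Finset α) : ℕ := ρ Z + ρ (E \ Z) - ρ E

theorem RS.lamb_le (h : RS E ρ) (Z : Finset α) : lamb E ρ Z ≤ ρ Z := by
  have := h.mono (E \ Z) E Finset.sdiff_subset
  unfold lamb; omega

theorem RS.lamb_add (h : RS E ρ) {Z : Finset α} (hZ : Z ⊆ E) :
    lamb E ρ Z + ρ E = ρ Z + ρ (E \ Z) := by
  have := h.union_le Z (E \ Z)
  rw [Finset.union_sdiff_of_subset hZ] at this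
  unfold lamb; omega

theorem RS.small (h : RS E ρ) {Z : Finset α} (hZ : Z ⊆ E) (h3 : 3 ≤ ρ (E \ Z))
    (h2 : lamb E ρ Z ≤ 2) : ρ Z = lamb E ρ Z ∧ ρ (E \ Z) = ρ E := by
  have h4 := h.lamb_add hZ
  rcases h.V Z hZ (by omega) with h' | h' <;> omega

theorem RS.SL (h : RS E ρ) {Z : Finset α} (hZ : Z ⊆ E) (h3 : 3 ≤ ρ (E \ Z)) :
    SL Z.card (lamb E ρ Z) := by
  have h1 := h.le_card Z
  have h2 := h.lamb_le Z
  unfold _root_.SL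
  by_cases hl : lamb E ρ Z ≤ 2
  · have := (h.small hZ h3 hl).1
    have c2 := h.card2 hZ
    have c1 := h.card1 hZ
    have c0 := h.card0 hZ
    omega
  · omega

theorem RS.pair (h : RS E ρ) {a b c : α} (t : Tri E ρ a b c) {Xa Ya Xb Yb Xc Yc : Finset α}
    (sa : TSep E ρ a Xa Ya) (sb : TSep E ρ b Xb Yb) (sc : TSep E ρ c Xc Yc)
    (hb : b ∈ Xa) (hc : c ∈ Ya) (ha : a ∈ Xb) (hc' : c ∈ Yb) :
    PairFacts (ρ E) (Xa ∩ Xb).card (Xa ∩ Yb).card (Ya ∩ Xb).card (Ya ∩ Yb).card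
      ((Ya ∩ Yb) ∩ Xc).card ((Ya ∩ Yb) ∩ Yc).card (lamb E ρ (Xa ∩ Xb)) (lamb E ρ (Xa ∩ Yb))
      (lamb E ρ (Ya ∩ Xb)) (lamb E ρ (Ya ∩ Yb)) (ρ Xa) (ρ Xb) := by
  have ma := sa.mem
  have da := sa.disj
  have mb := sb.mem
  have db := sb.disj
  have eaX := sa.eX
  have eaY := sa.eY
  have ebX := sb.eX
  have ebY := sb.eY
  have EP : E \ (Xa ∩ Xb) = insert a (insert b (Ya ∪ Yb)) := by
    ext x; simp only [Finset.mem_sdiff, Finset.mem_inter, Finset.mem_insert, Finset.mem_union]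
    grind
  have EQ : E \ (Xa ∩ Yb) = insert b (Ya ∪ Xb) := by
    ext x; simp only [Finset.mem_sdiff, Finset.mem_inter, Finset.mem_insert, Finset.mem_union]
    grind
  have ER : E \ (Ya ∩ Xb) = insert a (Xa ∪ Yb) := by
    ext x; simp only [Finset.mem_sdiff, Finset.mem_inter, Finset.mem_insert, Finset.mem_union]
    grind
  have ES : E \ (Ya ∩ Yb) = Xa ∪ Xb := by
    ext x; simp only [Finset.mem_sdiff, Finset.mem_inter, Finset.mem_union]
    grind
  have EH : E \ (Ya ∪ Yb) = insert a (insert b (Xa ∩ Xb)) := by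
    ext x; simp only [Finset.mem_sdiff, Finset.mem_inter, Finset.mem_insert, Finset.mem_union]
    grind
  have P0 : Xa ∩ Xb ⊆ E := Finset.inter_subset_left.trans sa.subX
  have Q0 : Xa ∩ Yb ⊆ E := Finset.inter_subset_left.trans sa.subX
  have R0 : Ya ∩ Xb ⊆ E := Finset.inter_subset_left.trans sa.subY
  have S0 : Ya ∩ Yb ⊆ E := Finset.inter_subset_left.trans sa.subY
  have H0 : Ya ∪ Yb ⊆ E := Finset.union_subset sa.subY sb.subY
  have P3 : 3 ≤ ρ (E \ (Xa ∩ Xb)) := sa.three'.trans (h.mono _ _ (by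
    rw [EP]; intro x; simp; tauto))
  have Q3 : 3 ≤ ρ (E \ (Xa ∩ Yb)) := sa.three'.trans (h.mono _ _ (by
    rw [EQ]; intro x; simp; tauto))
  have R3 : 3 ≤ ρ (E \ (Ya ∩ Xb)) := sa.three.trans (h.mono _ _ (by
    rw [ER]; intro x; simp; tauto))
  have S3 : 3 ≤ ρ (E \ (Ya ∩ Yb)) := sa.three.trans (h.mono _ _ (by
    rw [ES]; intro x; simp; tauto))
  have lP := h.lamb_add P0
  have lQ := h.lamb_add Q0
  have lR := h.lamb_add R0
  have lS := h.lamb_add S0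
  have smP := h.small P0 P3
  have smQ := h.small Q0 Q3
  have smR := h.small R0 R3
  have smS := h.small S0 S3
  have SLP := h.SL P0 P3
  have SLQ := h.SL Q0 Q3
  have SLR := h.SL R0 R3
  have SLS := h.SL S0 S3
  have sPQ := h.submod Xa Xb
  have sQR := h.submod Xa Yb
  have sRQ := h.submod Ya Xb
  have sSP := h.submod Ya Yb
  have ea := (h.sepX sa).1
  have eb := (h.sepX sb).1
  have uQ : ρ (E \ (Xa ∩ Yb)) ≤ ρ (Ya ∪ Xb) := by
    rw [EQ]; exact h.tri t.rot.rot (by simp [hc]) (by simp [ha])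
  have uR : ρ (E \ (Ya ∩ Xb)) ≤ ρ (Xa ∪ Yb) := by
    rw [ER]; exact h.tri t.rot (by simp [hb]) (by simp [hc'])
  have uP : ρ (E \ (Xa ∩ Xb)) ≤ ρ (Ya ∪ Yb) + 1 := by
    rw [EP]
    refine le_trans (h.tri t.rot (by simp) (by simp [hc'])) (h.ins _ _)
  rw [ES] at lS smS
  have qr : lamb E ρ (Xa ∩ Yb) + lamb E ρ (Ya ∩ Xb) ≤ 4 := by omega
  have ps : lamb E ρ (Xa ∩ Xb) + lamb E ρ (Ya ∩ Yb) ≤ 5 := by omega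
  refine ⟨SLP, SLQ, SLR, SLS, qr, ps, ?_, ?_, ?_, ?_⟩
  · intro p2
    have := smP p2
    have hle := h.mono _ _ H0
    have : ρ (Ya ∪ Yb) + 1 ≠ ρ E := by
      intro hN
      have hN := h.N _ H0 hN
      rw [EH] at hN
      have c3 := h.card2 P0 (by omega)
      have c1 := Finset.card_insert_le a (insert b (Xa ∩ Xb))
      have c2 := Finset.card_insert_le b (Xa ∩ Xb)
      have := hN.2 (by omega) (Xa ∩ Xb) (by intro x; simp; tauto) (by omega)
      omega
    omega
  · intro s2
    have := smS s2
    have key : ∀ X Y, TSep E ρ c X Y → ((Ya ∩ Yb) ∩ X).card ≤ 1 := by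
      intro X Y s
      by_contra hcon
      have h1 := h.share S0 (B := X) (by omega)
      have h2 := h.mono (insert c X) (Ya ∩ Yb ∪ X) (by
        intro x; simp only [Finset.mem_insert, Finset.mem_union, Finset.mem_inter]
        rintro (rfl | h)
        · exact Or.inl ⟨hc, hc'⟩
        · exact Or.inr h)
      have := (h.sepX s).2
      omega
    exact ⟨key _ _ sc, key _ _ sc.symm⟩
  · intro q2 r2
    have := smQ q2.le
    have := smR r2.le
    omega
  · intro p2 s2
    have := smP p2
    have := smS s2
    omega

theorem RS.side (h : RS E ρ) {e f : α} {X Y P Q S Q' : Finset α} (s : TSep E ρ e X Y)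
    (hP : P ⊆ X) (hQ : Q ⊆ X) (hS : S ⊆ X) (hQ' : Q' ⊆ X) (h1 : X ⊆ insert f (P ∪ Q))
    (h2 : X ⊆ S ∪ Q') :
    SideFacts X.card (ρ X) P.card Q.card S.card Q'.card (lamb E ρ P) (lamb E ρ Q)
      (lamb E ρ S) (lamb E ρ Q') := by
  have sm : ∀ Z, Z ⊆ X → lamb E ρ Z ≤ 2 → ρ Z = lamb E ρ Z := by
    intro Z hZ hl
    refine (h.small (hZ.trans s.subX) (s.three'.trans (h.mono _ _ ?_)) hl).1
    intro x hx
    exact Finset.mem_sdiff.2 ⟨s.subY hx, fun hh => s.disj x (hZ hh) hx⟩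
  have hN : ρ X = 3 → 4 ≤ X.card ∧ (X.card = 4 → ∀ Z, Z ⊆ X → Z.card = 3 → 3 ≤ lamb E ρ Z) := by
    intro hx
    have := (h.sepX s).1
    have hN := h.N Y s.subY (by omega)
    rw [h.sepE s, Finset.card_insert_of_notMem s.eX] at hN
    refine ⟨by omega, fun hc Z hZ h3 => ?_⟩
    have := hN.2 (by omega) Z (hZ.trans (Finset.subset_insert _ _)) h3
    have := sm Z hZ
    omega
  refine ⟨s.three, ?_, ?_, fun hx => (hN hx).1, fun hx hc => ?_⟩
  · intro p q
    have := sm P hP p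
    have := sm Q hQ q
    have := h.mono _ _ h1
    have := h.ins f (P ∪ Q)
    have := h.union_le P Q
    omega
  · intro p q
    have := sm S hS p
    have := sm Q' hQ' q
    have := h.mono _ _ h2
    have := h.union_le S Q'
    omega
  · have := (hN hx).2 hc
    exact ⟨this P hP, this Q hQ, this S hS, this Q' hQ'⟩

theorem RS.split (_h : RS E ρ) {c : α} {X Y : Finset α} (s : TSep E ρ c X Y) (Z : Finset α)
    (hZ : Z ⊆ E) : (c ∉ Z → Z.card = (Z ∩ X).card + (Z ∩ Y).card) ∧
      (c ∈ Z → Z.card = 1 + (Z ∩ X).card + (Z ∩ Y).card) := by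
  have d : Disjoint (Z ∩ X) (Z ∩ Y) := by
    rw [Finset.disjoint_left]; intro x hx hy
    exact s.disj x (Finset.mem_inter.1 hx).2 (Finset.mem_inter.1 hy).2
  have m := s.mem
  constructor
  · intro hc
    rw [← Finset.card_union_of_disjoint d]
    congr 1
    ext x
    simp only [Finset.mem_union, Finset.mem_inter]
    grind
  · intro hc
    have : Z = insert c (Z ∩ X ∪ Z ∩ Y) := by
      ext x
      simp only [Finset.mem_union, Finset.mem_inter, Finset.mem_insert]
      grind
    have hn : c ∉ Z ∩ X ∪ Z ∩ Y := by
      have := s.eX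
      have := s.eY
      simp; tauto
    have e := congrArg Finset.card this
    rw [Finset.card_insert_of_notMem hn, Finset.card_union_of_disjoint d] at e
    omega

theorem RS.opp (h : RS E ρ) {a b c : α} (t : Tri E ρ a b c) {X Y : Finset α}
    (s : TSep E ρ a X Y) : (b ∈ X ∧ c ∈ Y) ∨ (c ∈ X ∧ b ∈ Y) := by
  have h1 := (h.sepX s).2
  have h2 := (h.sepX s.symm).2
  have mb := (s.mem b).1 t.hb
  have mc := (s.mem c).1 t.hc
  have hX : ¬ (b ∈ X ∧ c ∈ X) := fun hh => by
    have := h.tri t.rot hh.1 hh.2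
    omega
  have hY : ¬ (b ∈ Y ∧ c ∈ Y) := fun hh => by
    have := h.tri t.rot hh.1 hh.2
    omega
  have := t.ab
  have := t.ac
  grind

end abs

section abs
variable {α : Type u} [DecidableEq α] {E : Finset α} {ρ : Finset α → ℕ}

def meas (E : Finset α) (ρ : Finset α → ℕ) (X : Finset α) : ℕ := X.card * (ρ E + 1) + ρ X

theorem RS.meas_card (h : RS E ρ) {X Y : Finset α} (hX : X ⊆ E) (hY : Y ⊆ E)
    (hm : meas E ρ X ≤ meas E ρ Y) : X.card ≤ Y.card ∧ (X.card = Y.card → ρ X ≤ ρ Y) := by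
  have h1 := h.mono _ _ hX
  have h2 := h.mono _ _ hY
  unfold meas at hm
  refine ⟨?_, fun he => by rw [he] at hm; omega⟩
  by_contra hc
  have : (Y.card + 1) * (ρ E + 1) ≤ X.card * (ρ E + 1) := Nat.mul_le_mul_right _ (by omega)
  rw [Nat.add_mul] at this
  omega

theorem RS.shrink (h : RS E ρ) {e x : α} {X Y : Finset α} (s : TSep E ρ e X Y)
    (hmin : ∀ X' Y', TSep E ρ e X' Y' → meas E ρ X ≤ meas E ρ X') (h4 : 4 ≤ ρ X) (hx : x ∈ X) :
    ρ X ≤ ρ (X.erase x) := by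
  by_contra hc
  have h1 := h.ins x (X.erase x)
  rw [Finset.insert_erase hx] at h1
  have h2 := h.ins x Y
  have h3 := h.mono _ _ (Finset.subset_insert x Y)
  have m := s.mem
  have d := s.disj
  have eX := s.eX
  have eY := s.eY
  have s1 := s.sum
  have s2 := s.three'
  have s' : TSep E ρ e (X.erase x) (insert x Y) := by
    refine ⟨?_, ?_, ?_, ?_, by omega, by omega, by omega⟩
    · intro y; rw [m y]; simp only [Finset.mem_erase, Finset.mem_insert]; grind
    · intro y; simp only [Finset.mem_erase, Finset.mem_insert]; grind
    · simp only [Finset.mem_erase]; grind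
    · simp only [Finset.mem_insert]; grind
  have := (h.meas_card s.subX s'.subX (hmin _ _ s')).1
  rw [Finset.card_erase_of_mem hx] at this
  have := Finset.card_pos.2 ⟨x, hx⟩
  omega

set_option maxHeartbeats 4000000 in
theorem RS.core (h : RS E ρ) (hr : 5 ≤ ρ E) {a b c : α} (t : Tri E ρ a b c)
    {Ab Ac : Finset α} (sa : TSep E ρ a Ab Ac) (hb : b ∈ Ab) (hc : c ∈ Ac)
    (hmin : ∀ e X Y, e = a ∨ e = b ∨ e = c → TSep E ρ e X Y → meas E ρ Ab ≤ meas E ρ X) :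
    False := by
  obtain ⟨Ba, Bc, sb, haB, hcB⟩ : ∃ X Y, TSep E ρ b X Y ∧ a ∈ X ∧ c ∈ Y := by
    obtain ⟨X, Y, s⟩ := h.sep b t.hb
    rcases h.opp t.rot s with hh | hh
    · exact ⟨Y, X, s.symm, hh.2, hh.1⟩
    · exact ⟨X, Y, s, hh⟩
  obtain ⟨Ca, Cb, sc, haC, hbC⟩ : ∃ X Y, TSep E ρ c X Y ∧ a ∈ X ∧ b ∈ Y := by
    obtain ⟨X, Y, s⟩ := h.sep c t.hc
    rcases h.opp t.rot.rot s with hh | hh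
    · exact ⟨X, Y, s, hh⟩
    · exact ⟨Y, X, s.symm, hh.2, hh.1⟩
  have Fab := h.pair t sa sb sc hb hc haB hcB
  have Fbc := h.pair t.rot sb.symm sc.symm sa hcB haB hbC haC
  have Fca := h.pair t.rot.rot sc sa.symm sb haC hbC hc hb
  have ma := sa.mem
  have da := sa.disj
  have mb := sb.mem
  have db := sb.disj
  have mc := sc.mem
  have dc := sc.disj
  have eaX := sa.eX
  have eaY := sa.eY
  have ebX := sb.eX
  have ebY := sb.eY
  have ecX := sc.eX
  have ecY := sc.eY
  have Gab := h.side (P := Ab ∩ Ba) (Q := Ab ∩ Bc) (S := Cb ∩ Ab) (Q' := Ca ∩ Ab) (f := b) sa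
    (by grind) (by grind) (by grind) (by grind) (by grind) (by grind)
  have Gac := h.side (P := Ca ∩ Ac) (Q := Cb ∩ Ac) (S := Ac ∩ Bc) (Q' := Ac ∩ Ba) (f := c)
    sa.symm (by grind) (by grind) (by grind) (by grind) (by grind) (by grind)
  have Gbc := h.side (P := Bc ∩ Cb) (Q := Bc ∩ Ca) (S := Ac ∩ Bc) (Q' := Ab ∩ Bc) (f := c)
    sb.symm (by grind) (by grind) (by grind) (by grind) (by grind) (by grind)
  have Gba := h.side (P := Ab ∩ Ba) (Q := Ac ∩ Ba) (S := Ba ∩ Ca) (Q' := Ba ∩ Cb) (f := a)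
    sb (by grind) (by grind) (by grind) (by grind) (by grind) (by grind)
  have Gca := h.side (P := Ca ∩ Ac) (Q := Ca ∩ Ab) (S := Ba ∩ Ca) (Q' := Bc ∩ Ca) (f := a)
    sc (by grind) (by grind) (by grind) (by grind) (by grind) (by grind)
  have Gcb := h.side (P := Bc ∩ Cb) (Q := Ba ∩ Cb) (S := Cb ∩ Ab) (Q' := Cb ∩ Ac) (f := b)
    sc.symm (by grind) (by grind) (by grind) (by grind) (by grind) (by grind)
  have sA := sa.subX
  have sA' := sa.subY
  have sB := sb.subX
  have sB' := sb.subY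
  have sC := sc.subX
  have sC' := sc.subY
  have i1 : Ba ∩ Ca ∩ Ab = Ab ∩ Ba ∩ Ca := by grind
  have i2 : Cb ∩ Ab ∩ Ba = Ab ∩ Ba ∩ Cb := by grind
  have i3 : Cb ∩ Ab ∩ Bc = Ab ∩ Bc ∩ Cb := by grind
  have i3' : Bc ∩ Cb ∩ Ab = Ab ∩ Bc ∩ Cb := by grind
  have i4 : Bc ∩ Cb ∩ Ac = Ac ∩ Bc ∩ Cb := by grind
  have i4' : Cb ∩ Ac ∩ Bc = Ac ∩ Bc ∩ Cb := by grind
  have i5 : Ba ∩ Ca ∩ Ac = Ac ∩ Ba ∩ Ca := by grind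
  have i5' : Ca ∩ Ac ∩ Ba = Ac ∩ Ba ∩ Ca := by grind
  have i6 : Ca ∩ Ac ∩ Bc = Ac ∩ Bc ∩ Ca := by grind
  have i6' : Bc ∩ Ca ∩ Ac = Ac ∩ Bc ∩ Ca := by grind
  have i7 : Ca ∩ Ab ∩ Ba = Ab ∩ Ba ∩ Ca := by grind
  have i8 : Ca ∩ Ab ∩ Bc = Ab ∩ Bc ∩ Ca := by grind
  have i8' : Bc ∩ Ca ∩ Ab = Ab ∩ Bc ∩ Ca := by grind
  have i9 : Cb ∩ Ac ∩ Ba = Ac ∩ Ba ∩ Cb := by grind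
  have i9' : Ba ∩ Cb ∩ Ac = Ac ∩ Ba ∩ Cb := by grind
  have i10 : Ba ∩ Cb ∩ Ab = Ab ∩ Ba ∩ Cb := by grind
  have kPab := (h.split sc (Ab ∩ Ba) (by grind)).1 (by grind)
  have kQab := (h.split sc (Ab ∩ Bc) (by grind)).1 (by grind)
  have kRab := (h.split sc (Ac ∩ Ba) (by grind)).1 (by grind)
  have kSab := (h.split sc (Ac ∩ Bc) (by grind)).2 (by grind)
  have kPbc := (h.split sa (Bc ∩ Cb) (by grind)).1 (by grind)
  have kQbc := (h.split sa (Bc ∩ Ca) (by grind)).1 (by grind)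
  have kRbc := (h.split sa (Ba ∩ Cb) (by grind)).1 (by grind)
  have kSbc := (h.split sa (Ba ∩ Ca) (by grind)).2 (by grind)
  have kPca := (h.split sb (Ca ∩ Ac) (by grind)).1 (by grind)
  have kQca := (h.split sb (Ca ∩ Ab) (by grind)).1 (by grind)
  have kRca := (h.split sb (Cb ∩ Ac) (by grind)).1 (by grind)
  have kSca := (h.split sb (Cb ∩ Ab) (by grind)).2 (by grind)
  have kAb := (h.split sb Ab sA).2 hb
  have kAc := (h.split sc Ac sA').2 hc
  have kBa := (h.split sa Ba sB).2 haB
  have kBc := (h.split sc Bc sB').2 hcB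
  have kCa := (h.split sa Ca sC).2 haC
  have kCb := (h.split sb Cb sC').2 hbC
  have j1 : Ac ∩ Ca = Ca ∩ Ac := Finset.inter_comm _ _
  have j2 : Ac ∩ Cb = Cb ∩ Ac := Finset.inter_comm _ _
  have j3 : Ba ∩ Ab = Ab ∩ Ba := Finset.inter_comm _ _
  have j4 : Ba ∩ Ac = Ac ∩ Ba := Finset.inter_comm _ _
  have j5 : Ca ∩ Ab = Ca ∩ Ab := rfl
  have j6 : Cb ∩ Ba = Ba ∩ Cb := Finset.inter_comm _ _
  have j7 : Cb ∩ Bc = Bc ∩ Cb := Finset.inter_comm _ _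
  rw [i1, i5] at kSbc Fbc
  rw [i2, i3] at kSca Fca
  rw [i3', i4] at kPbc
  rw [i8', i6'] at kQbc
  rw [i10, i9'] at kRbc
  rw [i5', i6] at kPca
  rw [i7, i8] at kQca
  rw [i9, i4'] at kRca
  rw [j1, j2] at kAc
  rw [j3, j4] at kBa
  rw [j6, j7] at kCb
  have mle : ∀ e X Y, e = a ∨ e = b ∨ e = c → TSep E ρ e X Y →
      Ab.card ≤ X.card ∧ (Ab.card = X.card → ρ Ab ≤ ρ X) := fun e X Y he s =>
    h.meas_card sa.subX s.subX (hmin e X Y he s)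
  have mAc := (mle _ _ _ (by simp) sa.symm).1
  have mBc := (mle _ _ _ (by simp) sb.symm)
  have mBa := (mle _ _ _ (by simp) sb).1
  have mCa := (mle _ _ _ (by simp) sc).1
  have mCb := (mle _ _ _ (by simp) sc.symm).1
  have sm : ∀ e X Y Z, TSep E ρ e X Y → Z ⊆ X → lamb E ρ Z ≤ 2 → ρ Z = lamb E ρ Z := by
    intro e X Y Z s hZ hl
    refine (h.small (hZ.trans s.subX) (s.three'.trans (h.mono _ _ ?_)) hl).1
    intro x hx
    exact Finset.mem_sdiff.2 ⟨s.subY hx, fun hh => s.disj x (hZ hh) hx⟩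
  have smQab := sm _ _ _ (Ab ∩ Bc) sa Finset.inter_subset_left
  have smPab := sm _ _ _ (Ab ∩ Ba) sa Finset.inter_subset_left
  have smQbc := sm _ _ _ (Bc ∩ Ca) sb.symm Finset.inter_subset_left
  have smPbc := sm _ _ _ (Bc ∩ Cb) sb.symm Finset.inter_subset_left
  have smQca := sm _ _ _ (Ca ∩ Ab) sc Finset.inter_subset_left
  have smSab := sm _ _ _ (Ac ∩ Bc) sa.symm Finset.inter_subset_left
  have zgen : ∀ A B : Finset α, A ⊆ E → B ⊆ E → 2 ≤ (A ∩ B).card → ρ A ≤ 2 → ρ B ≤ 2 →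
      A.card + B.card ≤ 3 + (A ∩ B).card := by
    intro A B hA hB h2 hA2 hB2
    have h1 := h.share hA h2
    have h3 := h.card2 (Finset.union_subset hA hB) (by omega)
    have := Finset.card_union_add_card_inter A B
    omega
  have z1a := zgen (Ab ∩ Bc) (Bc ∩ Ca) (by grind) (by grind)
  have z1b := zgen (Ab ∩ Bc) (Ca ∩ Ab) (by grind) (by grind)
  have zi : (Ab ∩ Bc) ∩ (Bc ∩ Ca) = Ab ∩ Bc ∩ Ca := by grind
  have zi' : (Ab ∩ Bc) ∩ (Ca ∩ Ab) = Ab ∩ Bc ∩ Ca := by grind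
  rw [zi] at z1a
  rw [zi'] at z1b
  have cab : 4 ≤ ρ Ab → ρ Ab ≤ ρ (Ab ∩ Ba) + ρ (Ab ∩ Bc) := by
    intro h4
    have h1 := h.shrink sa (fun X' Y' s' => hmin _ _ _ (by simp) s') h4 hb
    have h2 := h.mono (Ab.erase b) (Ab ∩ Ba ∪ Ab ∩ Bc) (by grind)
    have h3 := h.union_le (Ab ∩ Ba) (Ab ∩ Bc)
    omega
  have hBc : Ab.card = Bc.card → ρ Bc = ρ Ab → meas E ρ Ab = meas E ρ Bc := by
    intro h1 h2; unfold meas; rw [h1, h2]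
  have cbc0 : 4 ≤ ρ Bc → Ab.card = Bc.card → ρ Bc = ρ Ab → ∀ x ∈ Bc, ρ Bc ≤ ρ (Bc.erase x) := by
    intro h4 h1 h2 x hx
    exact h.shrink sb.symm (fun X' Y' s' => (hBc h1 h2) ▸ hmin _ _ _ (by simp) s') h4 hx
  have cbc : 4 ≤ ρ Bc → Ab.card = Bc.card → ρ Bc = ρ Ab → ρ Bc ≤ ρ (Bc ∩ Cb) + ρ (Bc ∩ Ca) := by
    intro h4 h1 h2
    have h1 := cbc0 h4 h1 h2 c hcB
    have h2 := h.mono (Bc.erase c) (Bc ∩ Cb ∪ Bc ∩ Ca) (by grind)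
    have h3 := h.union_le (Bc ∩ Cb) (Bc ∩ Ca)
    omega
  have cbc' : 4 ≤ ρ Bc → Ab.card = Bc.card → ρ Bc = ρ Ab → 1 ≤ (Ab ∩ Bc).card →
      ρ Bc + 1 ≤ (Ab ∩ Bc).card + ρ (Ac ∩ Bc) := by
    intro h4 h1 h2 hq
    obtain ⟨x, hx⟩ := Finset.card_pos.1 hq
    have h1 := cbc0 h4 h1 h2 x (Finset.mem_inter.1 hx).2
    have h2 := h.mono (Bc.erase x) ((Ab ∩ Bc).erase x ∪ Ac ∩ Bc) (by grind)
    have h3 := h.union_le ((Ab ∩ Bc).erase x) (Ac ∩ Bc)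
    have h5 := h.le_card ((Ab ∩ Bc).erase x)
    rw [Finset.card_erase_of_mem hx] at h5
    omega
  have ea := (h.sepX sa).1
  have eb := (h.sepX sb.symm).1
  have ec := (h.sepX sc).1
  have nAb : Ab.card = 1 + (Ab ∩ Ba ∩ Ca).card + (Ab ∩ Ba ∩ Cb).card + (Ab ∩ Bc ∩ Ca).card +
    (Ab ∩ Bc ∩ Cb).card := by omega
  have nAc : Ac.card = 1 + (Ac ∩ Ba ∩ Ca).card + (Ac ∩ Bc ∩ Ca).card + (Ac ∩ Ba ∩ Cb).card +
    (Ac ∩ Bc ∩ Cb).card := by omega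
  have nBc : Bc.card = 1 + (Ab ∩ Bc ∩ Cb).card + (Ac ∩ Bc ∩ Cb).card + (Ab ∩ Bc ∩ Ca).card +
    (Ac ∩ Bc ∩ Ca).card := by rw [Finset.inter_comm Bc Ca, Finset.inter_comm Bc Cb] at *; omega
  have nBa : Ba.card = 1 + (Ab ∩ Ba ∩ Ca).card + (Ab ∩ Ba ∩ Cb).card + (Ac ∩ Ba ∩ Cb).card +
    (Ac ∩ Ba ∩ Ca).card := by omega
  have nCa : Ca.card = 1 + (Ac ∩ Ba ∩ Ca).card + (Ac ∩ Bc ∩ Ca).card + (Ab ∩ Bc ∩ Ca).card +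
    (Ab ∩ Ba ∩ Ca).card := by omega
  have nCb : Cb.card = 1 + (Ab ∩ Bc ∩ Cb).card + (Ac ∩ Bc ∩ Cb).card + (Ac ∩ Ba ∩ Cb).card +
    (Ab ∩ Ba ∩ Cb).card := by omega
  clear i1 i2 i3 i3' i4 i4' i5 i5' i6 i6' i7 i8 i8' i9 i9' i10 j1 j2 j3 j4 j5 j6 j7 zi zi'
  clear ma mb mc da db dc eaX eaY ebX ebY ecX ecY sA sA' sB sB' sC sC' kAb kAc kBa kBc kCa kCb
  rw [nAb] at mAc mBc mBa mCa mCb cbc cbc' Gab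
  rw [nAc] at mAc Gac
  rw [nBc] at mBc Gbc cbc cbc'
  rw [nBa] at mBa Gba
  rw [nCa] at mCa Gca
  rw [nCb] at mCb Gcb
  rw [kQab] at cbc' z1a z1b Fab Gab Gbc
  rw [kPab] at Fab Gab Gba
  rw [add_comm] at kRab
  rw [kRab] at Fab Gac Gba
  have kSab' : (Ac ∩ Bc).card = 1 + (Ac ∩ Bc ∩ Ca).card + (Ac ∩ Bc ∩ Cb).card := kSab
  rw [kSab'] at Fab Gac Gbc
  rw [kPbc] at Fbc Gbc Gcb
  rw [kQbc] at Fbc Gbc Gca z1a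
  rw [add_comm] at kRbc
  rw [kRbc] at Fbc Gba Gcb
  rw [kSbc] at Fbc Gba Gca
  rw [kPca] at Fca Gac Gca
  rw [add_comm] at kQca
  rw [kQca] at Fca Gab Gca z1b
  rw [kRca] at Fca Gac Gcb
  rw [kSca] at Fca Gab Gcb
  refine numeric (Ab ∩ Ba ∩ Ca).card (Ab ∩ Ba ∩ Cb).card (Ab ∩ Bc ∩ Cb).card (Ac ∩ Bc ∩ Cb).card
    (Ac ∩ Ba ∩ Ca).card (Ac ∩ Bc ∩ Ca).card (Ab ∩ Bc ∩ Ca).card (Ac ∩ Ba ∩ Cb).card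
    _ _ _ _ _ _ _ _ _ _ _ _ (ρ E) _ _ _ _ _ _ hr ea eb ec Fab Fbc Fca Gab Gac Gbc Gba Gca Gcb
    ?_ ?_ ?_ ?_ ?_ ?_ ?_ ?_ ?_ ?_ ?_
  · clear * - z1a smQab smQbc
    intro h1 h2 h3
    have := smQab h2
    have := smQbc h3
    have := z1a h1 (by omega) (by omega)
    omega
  · clear * - z1b smQab smQca
    intro h1 h2 h3
    have := smQab h2
    have := smQca h3
    have := z1b h1 (by omega) (by omega)
    omega
  · clear * - mAc; omega
  · clear * - mBc; omega
  · clear * - mBa; omega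
  · clear * - mCa; omega
  · clear * - mCb; omega
  · clear * - mBc; intro h; exact mBc.2 (by omega)
  · intro h1 h2 h3
    have := smPab h2
    have := smQab h3
    have := cab h1
    omega
  · intro h1 h2 h3 h4 h5
    have := smPbc h4
    have := smQbc h5
    have := cbc h1 (by clear * - h2; omega) h3
    omega
  · intro h1 h2 h3 h4 h5
    have := smSab h5
    have := cbc' h1 (by clear * - h2; omega) h3 h4
    omega

theorem RS.rank5 (h : RS E ρ) (hr : 5 ≤ ρ E) {a b c : α} (t : Tri E ρ a b c) : False := by
  classical
  have hex : ∃ n, ∃ e X Y, (e = a ∨ e = b ∨ e = c) ∧ TSep E ρ e X Y ∧ meas E ρ X = n := by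
    obtain ⟨X, Y, s⟩ := h.sep a t.ha
    exact ⟨_, a, X, Y, Or.inl rfl, s, rfl⟩
  obtain ⟨e, X, Y, he, s, hn⟩ := Nat.find_spec hex
  have hmin : ∀ e' X' Y', e' = a ∨ e' = b ∨ e' = c → TSep E ρ e' X' Y' →
      meas E ρ X ≤ meas E ρ X' := by
    intro e' X' Y' he' s'
    rw [hn]
    exact Nat.find_min' hex ⟨e', X', Y', he', s', rfl⟩
  have key : ∀ a' b' c', Tri E ρ a' b' c' → e = a' →
      (∀ x, x = a' ∨ x = b' ∨ x = c' → x = a ∨ x = b ∨ x = c) → False := by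
    rintro a' b' c' t' rfl hx
    rcases h.opp t' s with ⟨h1, h2⟩ | ⟨h1, h2⟩
    · exact h.core hr t' s h1 h2 (fun e' X' Y' he' s' => hmin e' X' Y' (hx _ he') s')
    · exact h.core hr t'.swap s h1 h2
        (fun e' X' Y' he' s' => hmin e' X' Y' (hx _ (by tauto)) s')
  rcases he with he | he | he
  · exact key a b c t he (by tauto)
  · exact key b c a t.rot he (by tauto)
  · exact key c a b t.rot.rot he (by tauto)

end abs

section abs
variable {α : Type u} [DecidableEq α] {E : Finset α} {ρ : Finset α → ℕ}

theorem RS.coloops (h : RS E ρ) (Z : Finset α) (K : Finset α) (hK : K ⊆ Z)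
    (hc : ∀ k ∈ K, ρ (Z.erase k) + 1 ≤ ρ Z) : ρ (Z \ K) + K.card ≤ ρ Z := by
  induction K using Finset.induction_on with
  | empty => simp
  | insert k K hk ih =>
    have ih := ih (fun x hx => hK (by simp [hx])) (fun x hx => hc x (by simp [hx]))
    have h1 := h.submod (Z.erase k) (Z \ K)
    have hkZ := hK (Finset.mem_insert_self k K)
    have e1 : Z.erase k ∪ Z \ K = Z := by grind
    have e2 : Z.erase k ∩ (Z \ K) = Z \ insert k K := by grind
    rw [e1, e2] at h1
    have := hc k (by simp)
    rw [Finset.card_insert_of_notMem hk]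
    omega

theorem RS.good (h : RS E ρ) (hr : ρ E = 4) {a b c : α} (t : Tri E ρ a b c) (e : α)
    (he : e ∈ E) (heT : e ∉ ({a, b, c} : Finset α)) :
    ∃ F, F ⊆ E ∧ {a, b, c} ⊆ F ∧ ρ F = 3 ∧ (∀ F', F' ⊆ E → ρ F' = 3 → F ⊆ F' → F' = F) ∧
      e ∈ E \ F ∧ ρ ((E \ F).erase e) + 1 ≤ ρ (E \ F) ∧ 5 ≤ F.card ∧ 5 ≤ (E \ F).card := by
  obtain ⟨X, Y, s, h2⟩ : ∃ X Y, TSep E ρ e X Y ∧ ρ (X ∪ {a, b, c}) ≤ ρ X := by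
    obtain ⟨X, Y, s⟩ := h.sep e he
    have key : ∀ X : Finset α, (a ∈ X ∧ b ∈ X) ∨ (b ∈ X ∧ c ∈ X) ∨ (c ∈ X ∧ a ∈ X) →
        ρ (X ∪ {a, b, c}) ≤ ρ X := by
      rintro X (hh | hh | hh)
      · have e1 : X ∪ {a, b, c} = insert c X := by grind
        rw [e1]; exact h.tri t hh.1 hh.2
      · have e1 : X ∪ {a, b, c} = insert a X := by grind
        rw [e1]; exact h.tri t.rot hh.1 hh.2
      · have e1 : X ∪ {a, b, c} = insert b X := by grind
        rw [e1]; exact h.tri t.rot.rot hh.1 hh.2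
    have ma := (s.mem a).1 t.ha
    have mb := (s.mem b).1 t.hb
    have mc := (s.mem c).1 t.hc
    simp only [Finset.mem_insert, Finset.mem_singleton, not_or] at heT
    have : ((a ∈ X ∧ b ∈ X) ∨ (b ∈ X ∧ c ∈ X) ∨ (c ∈ X ∧ a ∈ X)) ∨
      ((a ∈ Y ∧ b ∈ Y) ∨ (b ∈ Y ∧ c ∈ Y) ∨ (c ∈ Y ∧ a ∈ Y)) := by grind
    rcases this with hh | hh
    · exact ⟨X, Y, s, key X hh⟩
    · exact ⟨Y, X, s.symm, key Y hh⟩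
  have hTE : ({a, b, c} : Finset α) ⊆ E := by
    intro x hx
    simp only [Finset.mem_insert, Finset.mem_singleton] at hx
    rcases hx with rfl | rfl | rfl
    · exact t.ha
    · exact t.hb
    · exact t.hc
  have hs := h.sepX s
  have hs' := h.sepX s.symm
  have h3 := s.three
  have h3' := s.three'
  have hXT := h.mono X (X ∪ {a, b, c}) Finset.subset_union_left
  -- choose a maximal F
  have hne : (E.powerset.filter (fun F => X ∪ {a, b, c} ⊆ F ∧ ρ F = 3)).Nonempty := by
    refine ⟨X ∪ {a, b, c}, ?_⟩
    simp only [Finset.mem_filter, Finset.mem_powerset]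
    exact ⟨Finset.union_subset s.subX hTE, Finset.Subset.refl _, by omega⟩
  obtain ⟨F, hF, hmax⟩ := Finset.exists_max_image _ Finset.card hne
  simp only [Finset.mem_filter, Finset.mem_powerset] at hF hmax
  obtain ⟨hFE, hXF, hF3⟩ := hF
  have hXF' : X ⊆ F := Finset.subset_union_left.trans hXF
  have hTF : {a, b, c} ⊆ F := Finset.subset_union_right.trans hXF
  have heF : e ∉ F := by
    intro hh
    have := h.mono (insert e X) F (by grind)
    omega
  have m := s.mem
  have eY := s.eY
  have eX := s.eX
  refine ⟨F, hFE, hTF, hF3, ?_, by simp [he, heF], ?_, ?_, (h.N F hFE (by omega)).1⟩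
  · intro F' hF' h3' hsub
    exact (Finset.eq_of_subset_of_card_le hsub (hmax F' ⟨hF', hXF.trans hsub, h3'⟩)).symm
  · have h1 := h.submod (E \ F) Y
    have e1 : (E \ F) ∩ Y = (E \ F).erase e := by
      ext x
      simp only [Finset.mem_inter, Finset.mem_sdiff, Finset.mem_erase]
      grind
    have e2 := h.mono (insert e Y) (E \ F ∪ Y) (by
      intro x
      simp only [Finset.mem_insert, Finset.mem_union, Finset.mem_sdiff]
      grind)
    rw [e1] at h1
    omega
  · by_contra hc
    have hN := h.N Y s.subY (by omega)
    rw [h.sepE s, Finset.card_insert_of_notMem eX] at hN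
    have hX : X = F := Finset.eq_of_subset_of_card_le hXF' (by omega)
    have := hN.2 (by rw [hX] at hN ⊢; omega) {a, b, c} (by rw [hX]; grind)
      (Finset.card_eq_three.2 ⟨a, b, c, t.ab, t.ac, t.bc, rfl⟩)
    have := t.rk
    omega

theorem RS.rank4 (h : RS E ρ) (hr : ρ E = 4) {a b c : α} (t : Tri E ρ a b c) : False := by
  classical
  set T : Finset α := {a, b, c} with hTdef
  have hTc : T.card = 3 := Finset.card_eq_three.2 ⟨a, b, c, t.ab, t.ac, t.bc, rfl⟩
  have hTE : T ⊆ E := by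
    intro x hx
    simp only [hTdef, Finset.mem_insert, Finset.mem_singleton] at hx
    rcases hx with rfl | rfl | rfl
    · exact t.ha
    · exact t.hb
    · exact t.hc
  have hex : ∀ e, ∃ F, e ∈ E \ T → F ⊆ E ∧ T ⊆ F ∧ ρ F = 3 ∧
      (∀ F', F' ⊆ E → ρ F' = 3 → F ⊆ F' → F' = F) ∧
      e ∈ E \ F ∧ ρ ((E \ F).erase e) + 1 ≤ ρ (E \ F) ∧ 5 ≤ F.card ∧ 5 ≤ (E \ F).card := by
    intro e
    by_cases he : e ∈ E \ T
    · obtain ⟨F, hF⟩ := h.good hr t e (Finset.mem_sdiff.1 he).1 (Finset.mem_sdiff.1 he).2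
      exact ⟨F, fun _ => hF⟩
    · exact ⟨∅, fun hh => absurd hh he⟩
  choose f hf using hex
  set V := E \ T with hV
  set I := V.image f with hI
  have hmeet : ∀ F ∈ I, ∀ F' ∈ I, F ≠ F' → F ∩ F' ⊆ T := by
    intro F hF F' hF' hne
    obtain ⟨e, he, rfl⟩ := Finset.mem_image.1 hF
    obtain ⟨e', he', rfl⟩ := Finset.mem_image.1 hF'
    obtain ⟨h1, h2, h3, h4, -⟩ := hf e he
    obtain ⟨h1', h2', h3', h4', -⟩ := hf e' he'
    have hu : ρ (f e ∪ f e') ≠ 3 := by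
      intro hu
      have e1 := h4 _ (Finset.union_subset h1 h1') hu Finset.subset_union_left
      have e2 := h4' _ (Finset.union_subset h1 h1') hu Finset.subset_union_right
      exact hne (e1.symm.trans e2)
    have := h.mono (f e) (f e ∪ f e') Finset.subset_union_left
    have := h.submod (f e) (f e')
    have hc := h.card2 (Z := f e ∩ f e') (Finset.inter_subset_left.trans h1) (by omega)
    have := Finset.eq_of_subset_of_card_le (Finset.subset_inter h2 h2') (by omega)
    rw [← this]
  have hD : ∑ F ∈ I, (F \ T).card ≤ V.card := by
    rw [← Finset.card_biUnion]
    · apply Finset.card_le_card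
      intro x hx
      obtain ⟨F, hF, hx⟩ := Finset.mem_biUnion.1 hx
      obtain ⟨e, he, rfl⟩ := Finset.mem_image.1 hF
      have := (hf e he).1
      grind
    · intro F hF F' hF' hne
      change Disjoint (F \ T) (F' \ T)
      rw [Finset.disjoint_left]
      intro x hx hx'
      have := hmeet F (Finset.mem_coe.1 hF) F' (Finset.mem_coe.1 hF') hne
      grind
  have hK : V.card = ∑ F ∈ I, (V.filter (fun e => f e = F)).card :=
    Finset.card_eq_sum_card_image f V
  have hKF : ∀ F ∈ I, (V.filter (fun e => f e = F)).card ≤ 2 ∧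
      ((V.filter (fun e => f e = F)).card = 2 → (E \ F).card = 5) ∧ 2 ≤ (F \ T).card ∧
      F.card = (F \ T).card + 3 ∧ E.card = (E \ F).card + F.card := by
    intro F hF
    obtain ⟨e, he, hfe⟩ := Finset.mem_image.1 hF
    obtain ⟨h1, h2, h3, h4, h5, h6, h7, h8⟩ := hf e he
    rw [hfe] at h1 h2 h3 h4 h5 h6 h7 h8
    set K := V.filter (fun e => f e = F) with hKdef
    have hKs : K ⊆ E \ F := by
      intro x hx
      obtain ⟨hx1, hx2⟩ := Finset.mem_filter.1 hx
      have := (hf x hx1).2.2.2.2.1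
      rwa [hx2] at this
    have hcol := h.coloops (E \ F) K hKs (by
      intro x hx
      obtain ⟨hx1, hx2⟩ := Finset.mem_filter.1 hx
      have := (hf x hx1).2.2.2.2.2.1
      rwa [hx2] at this)
    have hle := h.mono (E \ F) E Finset.sdiff_subset
    have hZ : (E \ F) \ K ⊆ E := Finset.sdiff_subset.trans Finset.sdiff_subset
    have c0 := h.card0 hZ
    have c1 := h.card1 hZ
    have c2 := h.card2 hZ
    have := Finset.card_sdiff_add_card_eq_card hKs
    have := Finset.card_sdiff_add_card_eq_card h2
    have := Finset.card_sdiff_add_card_eq_card h1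
    omega
  have hVne : V.Nonempty := by
    rw [Finset.nonempty_iff_ne_empty]
    intro h0
    have : E ⊆ T := Finset.sdiff_eq_empty_iff_subset.1 h0
    have := h.mono _ _ this
    have : ρ T ≤ 2 := t.rk
    omega
  have s1 : ∑ F ∈ I, (V.filter (fun e => f e = F)).card ≤ ∑ F ∈ I, 2 :=
    Finset.sum_le_sum (fun F hF => (hKF F hF).1)
  have s2 : ∑ F ∈ I, 2 ≤ ∑ F ∈ I, (F \ T).card :=
    Finset.sum_le_sum (fun F hF => (hKF F hF).2.2.1)
  have q1 := (Finset.sum_eq_sum_iff_of_le (fun F hF => (hKF F hF).1)).1 (by omega)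
  have q2 := (Finset.sum_eq_sum_iff_of_le (fun F hF => (hKF F hF).2.2.1)).1 (by omega)
  have hV2 : V.card = I.card * 2 := by
    have : ∑ F ∈ I, 2 = I.card * 2 := by simp
    omega
  obtain ⟨e, he⟩ := hVne
  have hF : f e ∈ I := Finset.mem_image_of_mem f he
  have k := hKF _ hF
  have k1 := q1 _ hF
  have k2 := q2 _ hF
  have := k.2.1 k1
  have hE := Finset.card_sdiff_add_card_eq_card hTE
  rw [← hV] at hE
  omega

end abs

theorem rank3_aux {α : Type u} [DecidableEq α] {E : Finset α} {ρ : Finset α → ℕ}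
    (mono : ∀ A B, A ⊆ B → ρ A ≤ ρ B)
    (submod : ∀ A B, ρ (A ∪ B) + ρ (A ∩ B) ≤ ρ A + ρ B)
    (lec : ∀ A, ρ A ≤ A.card)
    (size : ∀ Z, Z ⊆ E → Z.card < 2 ^ ρ Z) (h6 : 6 ≤ E.card)
    (sep : ∀ e ∈ E, ∃ X Y : Finset α, (∀ x, x ∈ E ↔ x ∈ X ∨ x ∈ Y ∨ x = e) ∧
      (∀ x, x ∈ X → x ∉ Y) ∧ e ∉ X ∧ e ∉ Y ∧ ρ X = 2 ∧ ρ Y = 2 ∧ 3 ≤ ρ (insert e X) ∧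
      3 ≤ ρ (insert e Y)) :
    ∃ Z, Z ⊆ E ∧ ρ Z = 2 ∧ (E \ Z).card = 4 ∧ ∀ x ∈ E, x ∉ Z → 3 ≤ ρ (insert x Z) := by
  have card2 : ∀ Z, Z ⊆ E → ρ Z ≤ 2 → Z.card ≤ 3 := by
    intro Z hZ h2
    have := size Z hZ
    have h3 : 2 ^ ρ Z ≤ 2 ^ 2 := Nat.pow_le_pow_right (by norm_num) h2
    omega
  have card1 : ∀ Z, Z ⊆ E → 2 ≤ Z.card → 2 ≤ ρ Z := by
    intro Z hZ h2
    by_contra hc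
    have := size Z hZ
    have h3 : 2 ^ ρ Z ≤ 2 ^ 1 := Nat.pow_le_pow_right (by norm_num) (by omega)
    omega
  have share : ∀ A B, A ⊆ E → 2 ≤ (A ∩ B).card → ρ (A ∪ B) + 2 ≤ ρ A + ρ B := by
    intro A B hA h2
    have := submod A B
    have := card1 (A ∩ B) (Finset.inter_subset_left.trans hA) h2
    omega
  obtain ⟨e, he⟩ : E.Nonempty := Finset.card_pos.1 (by omega)
  obtain ⟨X, Y, m, d, eX, eY, hX, hY, iX, iY, hle⟩ : ∃ X Y : Finset α,
      (∀ x, x ∈ E ↔ x ∈ X ∨ x ∈ Y ∨ x = e) ∧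
      (∀ x, x ∈ X → x ∉ Y) ∧ e ∉ X ∧ e ∉ Y ∧ ρ X = 2 ∧ ρ Y = 2 ∧ 3 ≤ ρ (insert e X) ∧
      3 ≤ ρ (insert e Y) ∧ Y.card ≤ X.card := by
    obtain ⟨X, Y, m, d, eX, eY, hX, hY, iX, iY⟩ := sep e he
    rcases le_total Y.card X.card with h | h
    · exact ⟨X, Y, m, d, eX, eY, hX, hY, iX, iY, h⟩
    · exact ⟨Y, X, fun x => by rw [m]; tauto, fun x h1 h2 => d x h2 h1, eY, eX, hY, hX, iY, iX, h⟩
  have sX : X ⊆ E := fun x hx => (m x).2 (Or.inl hx)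
  have sY : Y ⊆ E := fun x hx => (m x).2 (Or.inr (Or.inl hx))
  have cX := card2 X sX hX.le
  have cY := card2 Y sY hY.le
  have cE : E.card = X.card + Y.card + 1 := by
    have : E = insert e (X ∪ Y) := by ext x; simp only [Finset.mem_insert, Finset.mem_union, m]; tauto
    rw [this, Finset.card_insert_of_notMem (by simp [eX, eY]),
      Finset.card_union_of_disjoint (Finset.disjoint_left.2 d)]
  by_cases h7 : E.card = 7
  · refine ⟨X, sX, hX, ?_, ?_⟩
    · have := Finset.card_sdiff_add_card_eq_card sX
      omega
    · intro x hx hxX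
      by_contra hc
      have := card2 (insert x X) (by grind) (by omega)
      rw [Finset.card_insert_of_notMem hxX] at this
      omega
  have hX3 : X.card = 3 := by omega
  have hY2 : Y.card = 2 := by omega
  by_contra hcon
  have hthird : ∀ x, ∃ y, x ∈ X → y ∈ Y ∧ ρ {e, x, y} ≤ 2 := by
    intro x
    by_cases hx : x ∈ X
    · have hxe : e ≠ x := fun h => eX (h ▸ hx)
      by_contra hc
      push Not at hc
      have hs : ({e, x} : Finset α) ⊆ E := by
        intro y hy
        simp only [Finset.mem_insert, Finset.mem_singleton] at hy
        rcases hy with rfl | rfl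
        · exact he
        · exact sX hx
      have hc2 : ({e, x} : Finset α).card = 2 := Finset.card_pair hxe
      apply hcon
      refine ⟨{e, x}, hs, ?_, ?_, ?_⟩
      · have := lec {e, x}
        have := card1 {e, x} hs (by omega)
        omega
      · have := Finset.card_sdiff_add_card_eq_card hs
        omega
      · intro y hy hyn
        simp only [Finset.mem_insert, Finset.mem_singleton, not_or] at hyn
        have e1 : insert y ({e, x} : Finset α) = {e, x, y} := by ext z; simp; tauto
        rw [e1]
        by_contra h3
        rcases (m y).1 hy with h | h | h
        · have h1 := share {e, x, y} X (by
            intro z hz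
            simp only [Finset.mem_insert, Finset.mem_singleton] at hz
            rcases hz with rfl | rfl | rfl
            · exact he
            · exact sX hx
            · exact hy) (by
            rw [← Finset.card_pair hyn.2]
            apply Finset.card_le_card
            intro z hz
            simp only [Finset.mem_insert, Finset.mem_singleton] at hz
            rcases hz with rfl | rfl <;> simp [h, hx])
          have h2 := mono (insert e X) ({e, x, y} ∪ X) (by intro z; simp; tauto)
          omega
        · have := (hc y).2 h
          omega
        · exact hyn.1 h
    · exact ⟨x, fun h => absurd h hx⟩
  choose f hf using hthird
  obtain ⟨x, hx, x', hx', hne, hfx⟩ := Finset.exists_ne_map_eq_of_card_lt_of_maps_to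
    (s := X) (t := Y) (f := f) (by omega) (fun x hx => (hf x hx).1)
  have h1 := hf x hx
  have h2 := hf x' hx'
  rw [← hfx] at h2
  set y := f x
  have hye : e ≠ y := fun h => eY (h ▸ h1.1)
  have hs : ({e, x, y} : Finset α) ⊆ E := by
    intro z hz
    simp only [Finset.mem_insert, Finset.mem_singleton] at hz
    rcases hz with rfl | rfl | rfl
    · exact he
    · exact sX hx
    · exact sY h1.1
  have h3 := share {e, x, y} {e, x', y} hs (by
    rw [← Finset.card_pair hye]
    apply Finset.card_le_card
    intro z; simp; tauto)
  have h4 := share ({e, x, y} ∪ {e, x', y}) X (by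
    intro z hz
    rcases Finset.mem_union.1 hz with h | h
    · exact hs h
    · simp only [Finset.mem_insert, Finset.mem_singleton] at h
      rcases h with rfl | rfl | rfl
      · exact he
      · exact sX hx'
      · exact sY h1.1) (by
    rw [← Finset.card_pair hne]
    apply Finset.card_le_card
    intro z hz
    simp only [Finset.mem_insert, Finset.mem_singleton] at hz
    rcases hz with rfl | rfl <;> simp [hx, hx'])
  have h5 := mono (insert e X) (({e, x, y} ∪ {e, x', y}) ∪ X) (by intro z; simp; tauto)
  omega

structure SR {α : Type u} (E : Set α) (k : Set α → ℕ) : Prop where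
  mono : ∀ A B, A ⊆ B → k A ≤ k B
  submod : ∀ A B, k (A ∪ B) + k (A ∩ B) ≤ k A + k B
  empty : k ∅ = 0
  ins : ∀ x A, k (insert x A) ≤ k A + 1
  vc : ∀ j X Y, 0 < j → j < 4 → X ∪ Y = E → Disjoint X Y → k X + k Y < k E + j →
    j ≤ k X → j ≤ k Y → False
  del : ∀ e ∈ E, ∃ j X Y, 0 < j ∧ j < 4 ∧ X ∪ Y = E \ {e} ∧ Disjoint X Y ∧
    k X + k Y < k (E \ {e}) + j ∧ j ≤ k X ∧ j ≤ k Y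
  two : 2 ≤ k E

theorem SR.del' {α : Type u} {E : Set α} {k : Set α → ℕ} (h : SR E k) (e : α) (he : e ∈ E) :
    ∃ X Y, X ∪ Y = E \ {e} ∧ Disjoint X Y ∧ k (insert e X) = k X + 1 ∧
      k (insert e Y) = k Y + 1 ∧ ((k E = 2 ∧ k X = 1 ∧ k Y = 1) ∨ (k E = 3 ∧ k X = 2 ∧ k Y = 2) ∨
      (4 ≤ k E ∧ k X + k Y = k E + 2 ∧ 3 ≤ k X ∧ 3 ≤ k Y)) := by
  have h2 := h.two
  have hcol : k (E \ {e}) = k E := by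
    have h1 := h.mono (E \ {e}) E sdiff_subset
    have h3 := h.submod {e} (E \ {e})
    have h4 : ({e} : Set α) ∪ E \ {e} = E := by
      rw [union_sdiff_self]; exact union_eq_right.2 (by simpa using he)
    rw [h4] at h3
    have h5 := h.ins e ∅
    rw [h.empty] at h5
    have h6 : insert e (∅ : Set α) = {e} := by simp
    rw [h6] at h5
    by_contra hne
    exact h.vc 1 {e} (E \ {e}) (by norm_num) (by norm_num) h4 disjoint_sdiff_right (by omega)
      (by omega) (by omega)
  obtain ⟨j, X, Y, j0, j4, hu, hd, hs, hX, hY⟩ := h.del e he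
  rw [hcol] at hs
  have heX : e ∉ X := fun hh => by
    have : e ∈ E \ {e} := hu ▸ Or.inl hh
    simp at this
  have heY : e ∉ Y := fun hh => by
    have : e ∈ E \ {e} := hu ▸ Or.inr hh
    simp at this
  have u1 : insert e X ∪ Y = E := by
    rw [insert_union, hu, insert_sdiff_singleton, insert_eq_of_mem he]
  have u2 : X ∪ insert e Y = E := by
    rw [union_insert, hu, insert_sdiff_singleton, insert_eq_of_mem he]
  have d1 : Disjoint (insert e X) Y := disjoint_insert_left.2 ⟨heY, hd⟩
  have d2 : Disjoint X (insert e Y) := disjoint_insert_right.2 ⟨heX, hd⟩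
  have i1 := h.ins e X
  have i2 := h.ins e Y
  have m1 := h.mono _ _ (subset_insert e X)
  have m2 := h.mono _ _ (subset_insert e Y)
  have m3 := h.mono _ _ (u1 ▸ subset_union_left : insert e X ⊆ E)
  have v1 := h.vc j _ _ j0 j4 u1 d1
  have v2 := h.vc j _ _ j0 j4 u2 d2
  have w1 : ¬ (k (insert e X) + k Y < k E + j) := fun hh => v1 hh (by omega) hY
  have w2 : ¬ (k X + k (insert e Y) < k E + j) := fun hh => v2 hh hX (by omega)
  refine ⟨X, Y, hu, hd, by omega, by omega, ?_⟩
  by_cases j3 : j = 3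
  · omega
  · have y1 : ¬ (j + 1 ≤ k Y) := fun hh =>
      h.vc (j + 1) _ _ (by omega) (by omega) u1 d1 (by omega) (by omega) hh
    have y2 : ¬ (j + 1 ≤ k X) := fun hh =>
      h.vc (j + 1) _ _ (by omega) (by omega) u2 d2 (by omega) hh (by omega)
    omega

theorem SR.size {α : Type u} {E : Set α} {k : Set α → ℕ} (h : SR E k) (n : ℕ) :
    ∀ Z, Z ⊆ E → k Z ≤ n → Z.Finite ∧ Z.ncard < 2 ^ n := by
  induction n with
  | zero =>
    intro Z hZ h0
    have : Z = ∅ := by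
      by_contra hne
      obtain ⟨x, hx⟩ := nonempty_iff_ne_empty.2 hne
      obtain ⟨X, Y, hu, hd, iX, iY, -⟩ := h.del' x (hZ hx)
      have h1 := h.submod Z X
      have h2 := h.mono (insert x X) (Z ∪ X) (insert_subset (Or.inl hx) subset_union_right)
      omega
    subst this
    simp
  | succ n ih =>
    intro Z hZ hn
    rcases eq_empty_or_nonempty Z with rfl | ⟨x, hx⟩
    · simp
    obtain ⟨X, Y, hu, hd, iX, iY, -⟩ := h.del' x (hZ hx)
    have key : ∀ W, k (insert x W) = k W + 1 → k (Z ∩ W) ≤ n := by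
      intro X iX
      have h1 := h.submod Z X
      have h2 := h.mono (insert x X) (Z ∪ X) (insert_subset (Or.inl hx) subset_union_right)
      omega
    obtain ⟨f1, c1⟩ := ih (Z ∩ X) (inter_subset_left.trans hZ) (key X iX)
    obtain ⟨f2, c2⟩ := ih (Z ∩ Y) (inter_subset_left.trans hZ) (key Y iY)
    have hsub : Z ⊆ insert x (Z ∩ X ∪ Z ∩ Y) := by
      intro z hz
      by_cases hzx : z = x
      · exact Or.inl hzx
      · have : z ∈ X ∪ Y := by rw [hu]; exact ⟨hZ hz, hzx⟩
        rcases this with h | h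
        · exact Or.inr (Or.inl ⟨hz, h⟩)
        · exact Or.inr (Or.inr ⟨hz, h⟩)
    have hf : (insert x (Z ∩ X ∪ Z ∩ Y)).Finite := (f1.union f2).insert x
    refine ⟨hf.subset hsub, ?_⟩
    have := ncard_le_ncard hsub hf
    have := ncard_insert_le x (Z ∩ X ∪ Z ∩ Y)
    have := ncard_union_le (Z ∩ X) (Z ∩ Y)
    rw [pow_succ]
    omega

theorem SR.V {α : Type u} {E : Set α} {k : Set α → ℕ} (h : SR E k) (Z : Set α) (hZ : Z ⊆ E)
    (h2 : k Z + k (E \ Z) ≤ k E + 2) : k Z = k E ∨ k (E \ Z) = k E := by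
  have h1 := h.submod Z (E \ Z)
  rw [union_sdiff_cancel hZ] at h1
  have m1 := h.mono _ _ hZ
  have m2 := h.mono (E \ Z) E sdiff_subset
  by_contra hc
  push Not at hc
  exact h.vc (k Z + k (E \ Z) - k E + 1) Z (E \ Z) (by omega) (by omega) (union_sdiff_cancel hZ)
    disjoint_sdiff_right (by omega) (by omega) (by omega)

theorem mrk_eq {α : Type u} (M : Matroid α) (X : Set α) : mrk M X = M.eRk X := by
  unfold mrk
  apply le_antisymm
  · exact iSup₂_le fun I hI => hI.1.encard_le_eRk_of_subset hI.2
  · obtain ⟨I, h1, h2, h3⟩ := (Matroid.le_eRk_iff (M := M) (X := X) (n := M.eRk X)).1 le_rfl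
    rw [← h3]
    exact le_iSup₂ (f := fun (I : Set α) (_ : I ∈ {I : Set α | M.Indep I ∧ I ⊆ X}) => I.encard)
      I ⟨h2, h1⟩

theorem rankFinite_of {α : Type u} (M : Matroid α) (hM : VertConn M 4) : M.RankFinite := by
  rw [← Matroid.eRank_ne_top_iff]
  intro htop
  obtain ⟨B, hB⟩ := M.exists_isBase
  have hBt : B.encard = ⊤ := by rw [hB.encard_eq_eRank, htop]
  have hBi : B.Infinite := encard_eq_top_iff.1 hBt
  obtain ⟨e, he⟩ := hBi.nonempty
  obtain ⟨f, hf⟩ := (hBi.sdiff (finite_singleton e)).nonempty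
  have he1 : 1 ≤ M.eRk {e} := by
    have := (hB.indep.subset (singleton_subset_iff.2 he)).eRk_eq_encard
    rw [this]; simp
  have hf1 : 1 ≤ M.eRk {f} := by
    have := (hB.indep.subset (singleton_subset_iff.2 hf.1)).eRk_eq_encard
    rw [this]; simp
  have heE := hB.subset_ground he
  have hfE := hB.subset_ground hf.1
  refine hM 1 {e} (M.E \ {e}) (by norm_num) (by norm_num) ⟨?_, disjoint_sdiff_right, ?_, ?_, ?_⟩
  · exact union_sdiff_cancel (singleton_subset_iff.2 heE)
  · unfold lam mrank
    rw [mrk_eq M M.E, Matroid.eRk_ground, htop, ENat.sub_top]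
    simp
  · rw [mrk_eq]; exact_mod_cast he1
  · rw [mrk_eq]
    have hsub : ({f} : Set α) ⊆ M.E \ {e} := singleton_subset_iff.2 ⟨hfE, hf.2⟩
    exact_mod_cast hf1.trans (M.eRk_mono hsub)

noncomputable def nrk {α : Type u} (M : Matroid α) (X : Set α) : ℕ := (M.eRk X).toNat

theorem nrk_cast {α : Type u} (M : Matroid α) [M.RankFinite] (X : Set α) :
    M.eRk X = (nrk M X : ℕ∞) := by
  unfold nrk
  rw [ENat.natCast_toNat]
  exact ((M.eRk_le_eRank X).trans_lt (Matroid.eRank_lt_top_iff.2 inferInstance)).ne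

theorem lam_lt {α : Type u} (M : Matroid α) [M.RankFinite] (X Y : Set α) (j : ℕ) (hj : 0 < j)
    (hu : X ∪ Y = M.E) (hd : Disjoint X Y) :
    lam M X < (j : ℕ∞) ↔ nrk M X + nrk M Y < nrk M M.E + j := by
  have : M.E \ X = Y := by rw [← hu, union_sdiff_left, hd.sdiff_eq_right]
  unfold lam mrank
  rw [this, mrk_eq, mrk_eq, mrk_eq, nrk_cast, nrk_cast, nrk_cast]
  norm_cast
  omega

theorem isVSep_iff {α : Type u} (M : Matroid α) [M.RankFinite] (X Y : Set α) (j : ℕ)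
    (hj : 0 < j) : IsVSep M j X Y ↔ X ∪ Y = M.E ∧ Disjoint X Y ∧
      nrk M X + nrk M Y < nrk M M.E + j ∧ j ≤ nrk M X ∧ j ≤ nrk M Y := by
  unfold IsVSep
  constructor
  · rintro ⟨h1, h2, h3, h4, h5⟩
    rw [mrk_eq, nrk_cast] at h4 h5
    exact ⟨h1, h2, (lam_lt M X Y j hj h1 h2).1 h3, by exact_mod_cast h4, by exact_mod_cast h5⟩
  · rintro ⟨h1, h2, h3, h4, h5⟩
    rw [mrk_eq, mrk_eq, nrk_cast, nrk_cast]
    exact ⟨h1, h2, (lam_lt M X Y j hj h1 h2).2 h3, by exact_mod_cast h4, by exact_mod_cast h5⟩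

theorem SR_of {α : Type u} (M : Matroid α) [M.RankFinite] (hM : MinVertConn4 M)
    (h2 : 2 ≤ nrk M M.E) : SR M.E (nrk M) := by
  refine ⟨?_, ?_, ?_, ?_, ?_, ?_, h2⟩
  · intro A B hAB
    have := M.eRk_mono hAB
    rw [nrk_cast, nrk_cast] at this
    exact_mod_cast this
  · intro A B
    have := M.eRk_inter_add_eRk_union_le A B
    rw [nrk_cast, nrk_cast, nrk_cast, nrk_cast] at this
    have : nrk M (A ∩ B) + nrk M (A ∪ B) ≤ nrk M A + nrk M B := by exact_mod_cast this
    omega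
  · unfold nrk; simp
  · intro x A
    have := M.eRk_insert_le_add_one x A
    rw [nrk_cast, nrk_cast] at this
    exact_mod_cast this
  · intro j X Y j0 j4 hu hd hs hX hY
    exact hM.1 j X Y j0 j4 ((isVSep_iff M X Y j j0).2 ⟨hu, hd, hs, hX, hY⟩)
  · intro e he
    have := hM.2 e he
    unfold VertConn at this
    push Not at this
    obtain ⟨j, X, Y, j0, j4, hs⟩ := this
    have hrf : (mdel M {e}).RankFinite := by unfold mdel; infer_instance
    rw [isVSep_iff _ _ _ _ j0] at hs
    have hE : (mdel M {e}).E = M.E \ {e} := rfl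
    have hk : ∀ Z, Z ⊆ M.E \ {e} → nrk (mdel M {e}) Z = nrk M Z := by
      intro Z hZ
      unfold nrk mdel
      rw [Matroid.restrict_eRk_eq _ hZ]
    rw [hE] at hs
    obtain ⟨h1, h3, h4, h5, h6⟩ := hs
    have hX : X ⊆ M.E \ {e} := h1 ▸ subset_union_left
    have hY : Y ⊆ M.E \ {e} := h1 ▸ subset_union_right
    rw [hk X hX, hk Y hY, hk _ Subset.rfl] at h4
    rw [hk X hX] at h5
    rw [hk Y hY] at h6
    exact ⟨j, X, Y, j0, j4, h1, h3, h4, h5, h6⟩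

theorem nrk_le {α : Type u} (M : Matroid α) [M.RankFinite] (X : Set α) (n : ℕ) :
    nrk M X ≤ n ↔ M.eRk X ≤ n := by rw [nrk_cast]; norm_cast

theorem cocirc {α : Type u} (M : Matroid α) [M.RankFinite] (H : Set α) (hH : H ⊆ M.E)
    (h : nrk M H + 1 = nrk M M.E) : MCocircuit M (M.E \ M.closure H) := by
  have hsp : ∀ Z, Z ⊆ M.E → (M.Spanning Z ↔ nrk M M.E ≤ nrk M Z) := by
    intro Z hZ
    rw [Matroid.spanning_iff_eRk_le hZ, ← Matroid.eRk_ground, nrk_cast, nrk_cast]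
    norm_cast
  have hcl : nrk M (M.closure H) = nrk M H := by unfold nrk; rw [Matroid.eRk_closure_eq]
  have hco : ∀ Z, Z ⊆ M.E → (M✶.Indep Z ↔ nrk M M.E ≤ nrk M (M.E \ Z)) := by
    intro Z hZ
    rw [← hsp _ sdiff_subset, ← Matroid.coindep_iff_compl_spanning hZ]
  have hclE := M.closure_subset_ground H
  refine ⟨?_, ?_⟩
  · rw [← Matroid.not_indep_iff (by simpa using sdiff_subset), hco _ sdiff_subset,
      sdiff_sdiff_cancel_left hclE, hcl]
    omega
  · intro D hD
    obtain ⟨x, hx, hxD⟩ := exists_of_ssubset hD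
    rw [hco D (hD.subset.trans sdiff_subset)]
    have h1 := M.eRk_insert_eq_add_one (X := H) (e := x) hx
    rw [nrk_cast, nrk_cast] at h1
    have h2 : insert x H ⊆ M.E \ D := by
      refine insert_subset (show x ∈ M.E \ D from ⟨hx.1, hxD⟩) ?_
      intro y hy
      exact ⟨hH hy, fun hyD => (hD.subset hyD).2 (M.mem_closure_of_mem hy hH)⟩
    have h3 := M.eRk_mono h2
    rw [nrk_cast, nrk_cast] at h3
    have h1 : nrk M (insert x H) = nrk M H + 1 := by exact_mod_cast h1
    have h3 : nrk M (insert x H) ≤ nrk M (M.E \ D) := by exact_mod_cast h3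
    omega

theorem sep_fin {α : Type u} [DecidableEq α] {Ef : Finset α} {k : Set α → ℕ}
    (hS : SR (Ef : Set α) k) (e : α) (he : e ∈ Ef) : ∃ X Y : Finset α,
    (∀ x, x ∈ Ef ↔ x ∈ X ∨ x ∈ Y ∨ x = e) ∧ (∀ x, x ∈ X → x ∉ Y) ∧ e ∉ X ∧ e ∉ Y ∧
    k (insert e (X : Set α)) = k X + 1 ∧ k (insert e (Y : Set α)) = k Y + 1 ∧
    ((k Ef = 2 ∧ k X = 1 ∧ k Y = 1) ∨ (k Ef = 3 ∧ k X = 2 ∧ k Y = 2) ∨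
      (4 ≤ k Ef ∧ k X + k Y = k Ef + 2 ∧ 3 ≤ k X ∧ 3 ≤ k Y)) := by
  obtain ⟨X, Y, h1, h2, h3, h4, h5⟩ := hS.del' e (by simpa using he)
  have hX : X ⊆ Ef := (subset_union_left.trans h1.subset).trans sdiff_subset
  have hY : Y ⊆ Ef := (subset_union_right.trans h1.subset).trans sdiff_subset
  lift X to Finset α using Ef.finite_toSet.subset hX
  lift Y to Finset α using Ef.finite_toSet.subset hY
  have hm : ∀ x, (x ∈ X ∨ x ∈ Y) ↔ (x ∈ Ef ∧ x ≠ e) := by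
    intro x
    have := Set.ext_iff.1 h1 x
    simpa using this
  refine ⟨X, Y, ?_, ?_, ?_, ?_, h3, h4, h5⟩
  · intro x
    have := hm x
    by_cases hx : x = e
    · subst hx; tauto
    · tauto
  · intro x hx hy
    exact Set.disjoint_left.1 h2 (Finset.mem_coe.2 hx) (Finset.mem_coe.2 hy)
  · intro hx; exact ((hm e).1 (Or.inl hx)).2 rfl
  · intro hx; exact ((hm e).1 (Or.inr hx)).2 rfl

theorem final_aux {α : Type u} (M : Matroid α) (hM : MinVertConn4 M) (hcard : 6 ≤ M.E.encard)
    (T : Set α) (hT : IsTriangle M T) :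
    (∃ C, MCocircuit M C ∧ C.encard = 4) ∨
    (∃ C, MCocircuit M C ∧ C.encard = 5 ∧ ∃ T' ⊆ C, IsTriangle M T') := by
  classical
  have := rankFinite_of M hM.1
  obtain ⟨⟨hdep, hmin⟩, h3⟩ := hT
  have hTE := hdep.subset_ground
  have hTr := Matroid.eRk_lt_encard_iff_dep hTE |>.2 hdep
  obtain ⟨a, b, c, hab, hac, hbc, rfl⟩ := Set.encard_eq_three.1 h3
  have hTr2 : nrk M {a, b, c} ≤ 2 := by
    rw [h3, nrk_cast] at hTr
    have : nrk M {a, b, c} < 3 := by exact_mod_cast hTr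
    omega
  have hpair : M.Indep {a, b} := by
    apply hmin
    rw [Set.ssubset_iff_of_subset (by intro x; simp; tauto)]
    exact ⟨c, by simp, by simp [hac.symm, hbc.symm]⟩
  have h2 : 2 ≤ nrk M M.E := by
    have h := hpair.eRk_eq_encard
    rw [Set.encard_pair hab] at h
    have h' := M.eRk_mono hpair.subset_ground
    rw [h, nrk_cast] at h'
    exact_mod_cast h'
  have hS := SR_of M hM h2
  obtain ⟨Ef, hEf⟩ : ∃ Ef : Finset α, (Ef : Set α) = M.E :=
    (hS.size _ M.E Subset.rfl le_rfl).1.exists_finset_coe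
  have hsize : ∀ Z : Finset α, Z ⊆ Ef → Z.card < 2 ^ nrk M Z := by
    intro Z hZ
    have := (hS.size _ (Z : Set α) (by rw [← hEf]; exact_mod_cast hZ) le_rfl).2
    rwa [Set.ncard_coe_finset] at this
  have h6 : 6 ≤ Ef.card := by
    rw [← hEf, Set.encard_coe_eq_coe_finsetCard] at hcard
    exact_mod_cast hcard
  have hlec : ∀ A : Finset α, nrk M A ≤ A.card := by
    intro A
    rw [nrk_le, ← Set.encard_coe_eq_coe_finsetCard]
    exact M.eRk_le_encard _
  have hmono : ∀ A B : Finset α, A ⊆ B → nrk M A ≤ nrk M B :=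
    fun A B h => hS.mono _ _ (by exact_mod_cast h)
  have hsub : ∀ A B : Finset α, nrk M ↑(A ∪ B) + nrk M ↑(A ∩ B) ≤ nrk M A + nrk M B := by
    intro A B
    rw [Finset.coe_union, Finset.coe_inter]
    exact hS.submod _ _
  have hS' : SR (Ef : Set α) (nrk M) := by rw [hEf]; exact hS
  have hsep := sep_fin hS'
  rcases Nat.lt_or_ge (nrk M M.E) 4 with hlt | hge
  · have hr3 : nrk M (Ef : Set α) = 3 := by
      have := hsize Ef (Finset.Subset.refl _)
      rw [hEf] at this ⊢
      by_contra hne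
      have : nrk M M.E = 2 := by omega
      simp_all
      omega
    left
    obtain ⟨Z, hZE, hZ2, hZ4, hZx⟩ := rank3_aux (E := Ef) (ρ := fun A => nrk M (A : Set α))
      hmono hsub hlec hsize h6 (by
        intro e he
        obtain ⟨X, Y, q1, q2, q3, q4, q5, q6, q7⟩ := hsep e he
        refine ⟨X, Y, q1, q2, q3, q4, ?_⟩
        simp only [Finset.coe_insert]
        omega)
    simp only [Finset.coe_insert] at hZ2 hZx
    have hZE' : (Z : Set α) ⊆ M.E := by rw [← hEf]; exact_mod_cast hZE
    have hcl : M.closure (Z : Set α) = Z := by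
      apply Subset.antisymm _ (M.subset_closure _ hZE')
      intro x hx
      by_contra hxZ
      have hxE : x ∈ Ef := by
        have := M.closure_subset_ground _ hx
        rw [← hEf] at this; exact_mod_cast this
      have := hZx x hxE (by exact_mod_cast hxZ)
      have h7 : nrk M (insert x (Z : Set α)) = nrk M Z := by
        unfold nrk
        rw [← M.eRk_closure_eq (insert x (Z : Set α)), Matroid.closure_insert_eq_of_mem_closure hx,
          M.eRk_closure_eq]
      omega
    have := cocirc M Z hZE' (by rw [← hEf]; omega)
    refine ⟨_, this, ?_⟩
    rw [hcl, ← hEf, ← Finset.coe_sdiff, Set.encard_coe_eq_coe_finsetCard, hZ4]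
    rfl
  · by_contra hgoal
    push Not at hgoal
    obtain ⟨g1, g2⟩ := hgoal
    have hN : ∀ H : Finset α, H ⊆ Ef → nrk M H + 1 = nrk M Ef → 5 ≤ (Ef \ H).card ∧
        ((Ef \ H).card = 5 → ∀ Z, Z ⊆ Ef \ H → Z.card = 3 → 3 ≤ nrk M (Z : Set α)) := by
      intro H hH hr
      have hHE : (H : Set α) ⊆ M.E := by rw [← hEf]; exact_mod_cast hH
      rw [hEf] at hr
      have hco := cocirc M H hHE hr
      have hclE := M.closure_subset_ground (H : Set α)
      have hV := hS.V (M.closure H) hclE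
      have hclr : nrk M (M.closure H) = nrk M H := by unfold nrk; rw [M.eRk_closure_eq]
      have hC4 : 4 ≤ nrk M (M.E \ M.closure H) := by
        by_contra hc
        have := hV (by omega)
        omega
      have hCsub : M.E \ M.closure H ⊆ ((Ef \ H : Finset α) : Set α) := by
        rw [Finset.coe_sdiff, hEf]
        exact sdiff_subset_sdiff_right (M.subset_closure _ hHE)
      obtain ⟨C, hC⟩ : ∃ C : Finset α, (C : Set α) = M.E \ M.closure H :=
        ((Finset.finite_toSet _).subset hCsub).exists_finset_coe
      rw [← hC] at hC4 hCsub hco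
      have hCsub' : C ⊆ Ef \ H := by exact_mod_cast hCsub
      have hc1 := hlec C
      have hc2 := Finset.card_le_card hCsub'
      have hc3 : C.card ≠ 4 := by
        intro h4
        apply g1 C hco
        rw [Set.encard_coe_eq_coe_finsetCard, h4]; rfl
      refine ⟨by omega, ?_⟩
      intro h5 Z hZ hZ3
      by_contra hZr
      have hCe : C = Ef \ H := Finset.eq_of_subset_of_card_le hCsub' (by omega)
      have hZE : Z ⊆ Ef := hZ.trans Finset.sdiff_subset
      have hZE' : (Z : Set α) ⊆ M.E := by rw [← hEf]; exact_mod_cast hZE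
      refine g2 C hco ?_ Z ?_ ⟨⟨?_, ?_⟩, ?_⟩
      · rw [Set.encard_coe_eq_coe_finsetCard, hCe, h5]; rfl
      · rw [hCe]; exact_mod_cast hZ
      · rw [← Matroid.eRk_lt_encard_iff_dep hZE', Set.encard_coe_eq_coe_finsetCard, hZ3, nrk_cast]
        exact_mod_cast (by omega : nrk M (Z : Set α) < 3)
      · intro D hD
        lift D to Finset α using Z.finite_toSet.subset hD.subset
        have hDZ : D ⊂ Z := by exact_mod_cast hD
        have hd1 := Finset.card_lt_card hDZ
        have hd2 := hsize D (hDZ.subset.trans hZE)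
        rw [Matroid.indep_iff_eRk_eq_encard, Set.encard_coe_eq_coe_finsetCard, nrk_cast]
        have hd3 := hlec D
        have : nrk M (D : Set α) = D.card := by
          have hd4 : D.card ≤ 2 := by omega
          have hd5 : nrk M (D : Set α) ≤ 2 := by omega
          generalize nrk M (D : Set α) = r at hd2 hd3 hd5 ⊢
          generalize D.card = n at hd2 hd3 hd4 ⊢
          clear * - hd2 hd3 hd4 hd5
          interval_cases r <;> omega
        rw [this]
      · rw [Set.encard_coe_eq_coe_finsetCard, hZ3]; rfl
    have hRS : RS Ef (fun A => nrk M (A : Set α)) := by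
      refine ⟨hmono, hsub, ?_, ?_, hsize, ?_, hN, ?_⟩
      · simpa using hS.empty
      · intro x A
        simpa using hS.ins x A
      · intro Z hZ hz
        simp only [Finset.coe_sdiff] at hz ⊢
        exact hS'.V Z (by exact_mod_cast hZ) hz
      · intro e he
        obtain ⟨X, Y, q1, q2, q3, q4, q5, q6, q7⟩ := hsep e he
        rw [← hEf] at hge
        exact ⟨X, Y, q1, q2, q3, q4, by omega, by omega, by omega⟩
    have hmem : ∀ x, x ∈ ({a, b, c} : Set α) → x ∈ Ef := by
      intro x hx
      have := hTE hx
      rw [← hEf] at this; exact_mod_cast this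
    have ht : Tri Ef (fun A => nrk M (A : Set α)) a b c :=
      ⟨hmem a (by simp), hmem b (by simp), hmem c (by simp), hab, hac, hbc, by simpa using hTr2⟩
    rw [← hEf] at hge
    rcases Nat.lt_or_ge (nrk M (Ef : Set α)) 5 with h | h
    · exact hRS.rank4 (by omega) ht
    · exact hRS.rank5 h ht

/-- Every minimally vertically 4-connected matroid with at least six elements that contains a
triangle has a 4-element cocircuit, or a 5-element cocircuit containing a triangle. -/
theorem statement_15 (M : Matroid α) (hM : MinVertConn4 M) (hcard : 6 ≤ M.E.encard)
    (T : Set α) (hT : IsTriangle M T) :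
    (∃ C, MCocircuit M C ∧ C.encard = 4) ∨
    (∃ C, MCocircuit M C ∧ C.encard = 5 ∧ ∃ T' ⊆ C, IsTriangle M T') := by
  exact final_aux M hM hcard T hT
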